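/- Let Ω ⊂ ℝ^n be a bounded open set, let V ∈ C_0^∞(Ω) be real-valued (extended by 0 to ℝ^n), and let p ≥ 1 be an integer. Then there exist constants C > 0 and t_0 > 0 such that for all t ∈ (0, t_0), the series Σ_{j≥1} ∫_{ℝ^n} Γ_j^V(t,x,x) dx converges absolutely and | Σ_{j≥1} ∫_{ℝ^n} Γ_j^V(t,x,x) dx − t^{-n/2} Σ_{ℓ=1}^{p} t^ℓ 𝒫_{2ℓ}(V) | ≤ C t^{p+1-n/2}. -/

import Mathlib

open MeasureTheory Real

noncomputable def heatG (n : ℕ) (t : ℝ) (x : EuclideanSpace ℝ (Fin n)) : ℝ :=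
  (4 * Real.pi * t) ^ (-(n : ℝ) / 2) * Real.exp (-‖x‖ ^ 2 / (4 * t))

/-- The simplex `{0 < s_m < … < s_1 < 1}` (indices listed in decreasing order). -/
def simplex (m : ℕ) : Set (Fin m → ℝ) :=
  {s | StrictAnti s ∧ ∀ k, s k ∈ Set.Ioo (0 : ℝ) 1}

/-- `fnext s k = s (k+1)`, with the convention that it is `0` past the last index. -/
def fnext {m : ℕ} {E : Type*} [Zero E] (s : Fin m → E) (k : Fin m) : E :=
  if h : (k : ℕ) + 1 < m then s ⟨(k : ℕ) + 1, h⟩ else 0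

/-- The coefficient `c_{αʲ}` associated with a `(j+1)`-tuple `α` of multi-indices in `ℕⁿ`
(a tuple of length `j+1`, so that tuples of every length `≥ 1` are covered). -/
noncomputable def cCoeff (n j : ℕ) (α : Fin (j + 1) → Fin n → ℕ) : ℝ :=
  (∏ k, ∏ i, (Nat.factorial (α k i) : ℝ))⁻¹ *
    ∫ w : Fin (j + 1) → EuclideanSpace ℝ (Fin n),
      ∫ s in simplex (j + 1),
        (∏ k, ∏ i, w k i ^ α k i) *
          (heatG n (1 - s 0) (w 0) *
            ∏ k, heatG n (s k - fnext s k) (w k - fnext w k))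

/-- Partial derivative in the `i`-th coordinate direction. -/
noncomputable def pderiv1 {n : ℕ} (i : Fin n) (f : EuclideanSpace ℝ (Fin n) → ℝ) :
    EuclideanSpace ℝ (Fin n) → ℝ :=
  fun x => fderiv ℝ f x (EuclideanSpace.single i 1)

/-- The multi-index partial derivative `∂^α f`. -/
noncomputable def mderiv {n : ℕ} (α : Fin n → ℕ) (f : EuclideanSpace ℝ (Fin n) → ℝ) :
    EuclideanSpace ℝ (Fin n) → ℝ :=
  ((List.ofFn fun i : Fin n => (pderiv1 i)^[α i]).foldr (· ∘ ·) id) f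

/-- `P_{αʲ}(V) = ∫_Ω ∏_k ∂^{α_k} V`. -/
noncomputable def Pcoef (n j : ℕ) (Ω : Set (EuclideanSpace ℝ (Fin n)))
    (α : Fin (j + 1) → Fin n → ℕ) (V : EuclideanSpace ℝ (Fin n) → ℝ) : ℝ :=
  ∫ x in Ω, ∏ k, mderiv (α k) V x

/-- `P_{2ℓ}(V) = Σ_{j=1}^{ℓ} (-1)^j Σ_{|αʲ| = 2ℓ-2j} c_{αʲ} P_{αʲ}(V)`
(the inner sum, over the finitely many tuples of multi-indices of total order `2ℓ-2j`,
is written as a `tsum` over all tuples with an indicator). -/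
noncomputable def Pscr (n : ℕ) (Ω : Set (EuclideanSpace ℝ (Fin n))) (ℓ : ℕ)
    (V : EuclideanSpace ℝ (Fin n) → ℝ) : ℝ :=
  ∑ m ∈ Finset.range ℓ,
    (-1 : ℝ) ^ (m + 1) *
      ∑' α : Fin (m + 1) → Fin n → ℕ,
        if (∑ k, ∑ i, α k i) = 2 * ℓ - 2 * (m + 1) then
          cCoeff n m α * Pcoef n m Ω α V else 0

/-- The iterated kernels `Γⱼ^V`, defined recursively by
`Γ₀^V(t,x,y) = G(t,x-y)` and
`Γ_{j+1}^V(t,x,y) = -∫_0^t ∫ G(t-s,x-z) V(z) Γⱼ^V(s,z,y) dz ds`. -/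
noncomputable def Gam (n : ℕ) (V : EuclideanSpace ℝ (Fin n) → ℝ) :
    ℕ → ℝ → EuclideanSpace ℝ (Fin n) → EuclideanSpace ℝ (Fin n) → ℝ
  | 0 => fun t x y => heatG n t (x - y)
  | j + 1 => fun t x y =>
      -∫ s in Set.Ioo (0 : ℝ) t, ∫ z : EuclideanSpace ℝ (Fin n),
        heatG n (t - s) (x - z) * V z * Gam n V j s z y

lemma heatG_nonneg {n : ℕ} {t : ℝ} (ht : 0 ≤ t) (x : EuclideanSpace ℝ (Fin n)) :
    0 ≤ heatG n t x := by
  unfold heatG; positivity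

lemma heatG_neg {n : ℕ} (t : ℝ) (x : EuclideanSpace ℝ (Fin n)) :
    heatG n t (-x) = heatG n t x := by
  simp [heatG]

lemma measurable_heatG (n : ℕ) :
    Measurable fun q : ℝ × EuclideanSpace ℝ (Fin n) => heatG n q.1 q.2 := by
  unfold heatG
  fun_prop

lemma heatG_mul_heatG {n : ℕ} {a b : ℝ} (ha : 0 < a) (hb : 0 < b)
    (x z : EuclideanSpace ℝ (Fin n)) :
    heatG n a (x - z) * heatG n b z =
      heatG n (a + b) x * (((a + b) / (4 * a * b) / π) ^ ((n : ℝ) / 2) *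
        rexp (-((a + b) / (4 * a * b)) * ‖z - (b / (a + b)) • x‖ ^ 2)) := by
  have hab : 0 < a + b := by positivity
  have hc : (4 * π * a) ^ (-(n : ℝ) / 2) * (4 * π * b) ^ (-(n : ℝ) / 2) =
      (4 * π * (a + b)) ^ (-(n : ℝ) / 2) * ((a + b) / (4 * a * b) / π) ^ ((n : ℝ) / 2) := by
    rw [show ((a + b) / (4 * a * b) / π) = ((4 * a * b * π) / (a + b))⁻¹ by field_simp,
      inv_rpow (by positivity), ← rpow_neg (by positivity), ← neg_div,
      ← mul_rpow (by positivity) (by positivity), ← mul_rpow (by positivity) (by positivity)]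
    congr 1
    field_simp
  have he : rexp (-‖x - z‖ ^ 2 / (4 * a)) * rexp (-‖z‖ ^ 2 / (4 * b)) =
      rexp (-‖x‖ ^ 2 / (4 * (a + b))) *
        rexp (-((a + b) / (4 * a * b)) * ‖z - (b / (a + b)) • x‖ ^ 2) := by
    rw [← Real.exp_add, ← Real.exp_add]
    congr 1
    rw [norm_sub_sq_real, norm_sub_sq_real, norm_smul, inner_smul_right, real_inner_comm x z,
      mul_pow, Real.norm_eq_abs, sq_abs]
    field_simp
    ring
  unfold heatG
  rw [mul_mul_mul_comm, hc, he]
  ring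

lemma lintegral_heatG_mul_heatG {n : ℕ} {a b : ℝ} (ha : 0 < a) (hb : 0 < b)
    (x : EuclideanSpace ℝ (Fin n)) :
    ∫⁻ z, ENNReal.ofReal (heatG n a (x - z) * heatG n b z) =
      ENNReal.ofReal (heatG n (a + b) x) := by
  set c := (a + b) / (4 * a * b) with hc
  have hc0 : 0 < c := by positivity
  have h_gauss : ∫ z : EuclideanSpace ℝ (Fin n), rexp (-c * ‖z - (b / (a + b)) • x‖ ^ 2) =
      (π / c) ^ ((n : ℝ) / 2) := by
    rw [integral_sub_right_eq_self (fun z : EuclideanSpace ℝ (Fin n) => rexp (-c * ‖z‖ ^ 2)),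
      GaussianFourier.integral_rexp_neg_mul_sq_norm hc0]
    simp
  have hI : Integrable fun z : EuclideanSpace ℝ (Fin n) =>
      rexp (-c * ‖z - (b / (a + b)) • x‖ ^ 2) := by
    by_contra h
    rw [integral_undef h] at h_gauss
    have : 0 < (π / c) ^ ((n : ℝ) / 2) := by positivity
    linarith
  simp_rw [heatG_mul_heatG ha hb x, ← mul_assoc]
  have h0 : 0 ≤ heatG n (a + b) x := heatG_nonneg (by positivity) x
  rw [← ofReal_integral_eq_lintegral_ofReal (hI.const_mul _)
    (Filter.Eventually.of_forall fun z => by dsimp only; positivity), integral_const_mul, h_gauss,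
    mul_assoc, ← mul_rpow (by positivity) (by positivity)]
  rw [show c / π * (π / c) = 1 by field_simp]
  simp

lemma heatG_le_heatG_mul {n : ℕ} {c t : ℝ} (hc : 1 ≤ c) (ht : 0 < t)
    (x : EuclideanSpace ℝ (Fin n)) :
    heatG n t x ≤ c ^ ((n : ℝ) / 2) * heatG n (c * t) x := by
  have hc0 : 0 < c := by positivity
  unfold heatG
  rw [show 4 * π * (c * t) = c * (4 * π * t) by ring, mul_rpow hc0.le (by positivity : 0 ≤ 4 * π * t),
    ← mul_assoc, ← mul_assoc, ← rpow_add hc0, neg_div, add_neg_cancel, rpow_zero, one_mul]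
  have h : -‖x‖ ^ 2 / (4 * t) ≤ -‖x‖ ^ 2 / (4 * (c * t)) := by
    rw [neg_div, neg_div, neg_le_neg_iff]
    gcongr
    exact le_mul_of_one_le_left ht.le hc
  gcongr

lemma exists_pow_mul_heatG_le (n N : ℕ) (A : ℝ) :
    ∃ C : ℝ, 0 < C ∧ ∀ t ∈ Set.Ioc 0 A, ∀ x : EuclideanSpace ℝ (Fin n),
      (1 + ‖x‖) ^ N * heatG n t x ≤ C * heatG n (2 * t) x := by
  refine ⟨N.factorial * rexp (1 + 2 * A) * 2 ^ ((n : ℝ) / 2), by positivity, ?_⟩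
  rintro t ⟨ht, htA⟩ x
  have h1 : (1 + ‖x‖) ^ N ≤ N.factorial * rexp (1 + ‖x‖) := by
    have := Real.pow_div_factorial_le_exp (1 + ‖x‖) (by positivity) N
    rwa [div_le_iff₀ (by positivity), mul_comm] at this
  have h2 : rexp (1 + ‖x‖) * rexp (-‖x‖ ^ 2 / (4 * t)) ≤
      rexp (1 + 2 * A) * rexp (-‖x‖ ^ 2 / (4 * (2 * t))) := by
    rw [← Real.exp_add, ← Real.exp_add]
    gcongr 1
    have h3 : ‖x‖ ≤ ‖x‖ ^ 2 / (8 * t) + 2 * t := by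
      have : 0 ≤ (‖x‖ - 4 * t) ^ 2 / (8 * t) := by positivity
      have h4 : (‖x‖ - 4 * t) ^ 2 / (8 * t) = ‖x‖ ^ 2 / (8 * t) + 2 * t - ‖x‖ := by
        field_simp; ring
      linarith
    have h5 : -‖x‖ ^ 2 / (4 * t) = -(‖x‖ ^ 2 / (8 * t)) - ‖x‖ ^ 2 / (8 * t) := by
      field_simp; ring
    have h6 : -‖x‖ ^ 2 / (4 * (2 * t)) = - (‖x‖ ^ 2 / (8 * t)) := by
      field_simp; ring
    rw [h5, h6]; linarith
  have h7 : (4 * π * t) ^ (-(n : ℝ) / 2) =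
      2 ^ ((n : ℝ) / 2) * (4 * π * (2 * t)) ^ (-(n : ℝ) / 2) := by
    rw [show 4 * π * (2 * t) = 2 * (4 * π * t) by ring,
      mul_rpow zero_le_two (by positivity : 0 ≤ 4 * π * t), ← mul_assoc, ← rpow_add two_pos, neg_div, add_neg_cancel, rpow_zero, one_mul]
  unfold heatG
  rw [h7]
  calc _ ≤ (N.factorial * rexp (1 + ‖x‖)) * (2 ^ ((n : ℝ) / 2) *
      (4 * π * (2 * t)) ^ (-(n : ℝ) / 2) * rexp (-‖x‖ ^ 2 / (4 * t))) := by gcongr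
    _ = N.factorial * 2 ^ ((n : ℝ) / 2) * (4 * π * (2 * t)) ^ (-(n : ℝ) / 2) *
      (rexp (1 + ‖x‖) * rexp (-‖x‖ ^ 2 / (4 * t))) := by ring
    _ ≤ N.factorial * 2 ^ ((n : ℝ) / 2) * (4 * π * (2 * t)) ^ (-(n : ℝ) / 2) *
      (rexp (1 + 2 * A) * rexp (-‖x‖ ^ 2 / (4 * (2 * t)))) := by gcongr
    _ = _ := by ring

lemma heatG_sq_mul_smul {n : ℕ} {r t : ℝ} (hr : 0 < r) (ht : 0 ≤ t)
    (x : EuclideanSpace ℝ (Fin n)) :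
    heatG n (r ^ 2 * t) (r • x) = (r ^ n)⁻¹ * heatG n t x := by
  unfold heatG
  rw [show 4 * π * (r ^ 2 * t) = r ^ 2 * (4 * π * t) by ring,
    mul_rpow (by positivity) (by positivity), mul_assoc]
  congr 1
  · rw [← rpow_natCast r 2, ← rpow_mul hr.le, ← rpow_natCast r n, ← rpow_neg hr.le]
    congr 1; push_cast; ring
  · congr 2
    rw [norm_smul, Real.norm_eq_abs, abs_of_pos hr]
    rcases ht.eq_or_lt with rfl | ht
    · simp
    · field_simp

/-- The path-space density of the iterated heat kernels: `p k` is the `k`-th (time, position). -/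
noncomputable def pathDensity (n : ℕ) : (m : ℕ) → ℝ → EuclideanSpace ℝ (Fin n) →
    (Fin m → ℝ × EuclideanSpace ℝ (Fin n)) → ℝ
  | 0 => fun t x _ => heatG n t x
  | m + 1 => fun t x p => (Set.Ioo 0 t).indicator (fun s => heatG n (t - s) (x - (p 0).2) *
      pathDensity n m s (p 0).2 (Fin.tail p)) (p 0).1

lemma pathDensity_nonneg {n : ℕ} (m : ℕ) {t : ℝ} (ht : 0 ≤ t) (x : EuclideanSpace ℝ (Fin n))
    (p : Fin m → ℝ × EuclideanSpace ℝ (Fin n)) : 0 ≤ pathDensity n m t x p := by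
  induction m generalizing t x with
  | zero => exact heatG_nonneg ht x
  | succ m ih =>
    simp only [pathDensity]
    refine Set.indicator_nonneg (fun s hs => ?_) _
    exact mul_nonneg (heatG_nonneg (by linarith [hs.2]) _) (ih hs.1.le _ _)

lemma measurable_pathDensity (n m : ℕ) :
    Measurable fun q : (ℝ × EuclideanSpace ℝ (Fin n)) × (Fin m → ℝ × EuclideanSpace ℝ (Fin n)) =>
      pathDensity n m q.1.1 q.1.2 q.2 := by
  induction m with
  | zero => exact (measurable_heatG n).comp measurable_fst
  | succ m ih =>
    simp only [pathDensity, Set.indicator]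
    refine Measurable.ite ?_ ?_ measurable_const
    · have h0 : Measurable fun q : (ℝ × EuclideanSpace ℝ (Fin n)) ×
          (Fin (m + 1) → ℝ × EuclideanSpace ℝ (Fin n)) => (q.2 0).1 := by fun_prop
      exact (measurableSet_lt measurable_const h0).inter
        (measurableSet_lt h0 (by fun_prop : Measurable fun q : (ℝ × EuclideanSpace ℝ (Fin n)) ×
          (Fin (m + 1) → ℝ × EuclideanSpace ℝ (Fin n)) => q.1.1))
    · refine Measurable.mul ?_ ?_
      · exact (measurable_heatG n).comp (f := fun q : (ℝ × EuclideanSpace ℝ (Fin n)) ×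
          (Fin (m + 1) → ℝ × EuclideanSpace ℝ (Fin n)) => (q.1.1 - (q.2 0).1, q.1.2 - (q.2 0).2))
          (by fun_prop)
      · exact ih.comp (f := fun q : (ℝ × EuclideanSpace ℝ (Fin n)) ×
          (Fin (m + 1) → ℝ × EuclideanSpace ℝ (Fin n)) => (q.2 0, Fin.tail q.2))
          (by unfold Fin.tail; fun_prop)

lemma measurable_pathDensity_right (n m : ℕ) (t : ℝ) (x : EuclideanSpace ℝ (Fin n)) :
    Measurable (pathDensity n m t x) :=
  (measurable_pathDensity n m).comp (f := fun p => ((t, x), p)) (by fun_prop)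

lemma piFinSuccAbove_zero_symm_apply {α : Type*} [MeasurableSpace α] {m : ℕ}
    (q : α × (Fin m → α)) :
    (MeasurableEquiv.piFinSuccAbove (fun _ : Fin (m + 1) => α) 0).symm q = Fin.cons q.1 q.2 := by
  simp [MeasurableEquiv.piFinSuccAbove, Fin.insertNthEquiv]

lemma lintegral_pi_fin_succ {α : Type*} [MeasureSpace α] [SigmaFinite (volume : Measure α)]
    {m : ℕ} (F : (Fin (m + 1) → α) → ENNReal) (hF : Measurable F) :
    ∫⁻ p, F p = ∫⁻ a : α, ∫⁻ p : Fin m → α, F (Fin.cons a p) := by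
  have h := volume_preserving_piFinSuccAbove (fun _ : Fin (m + 1) => α) 0
  rw [← h.symm.lintegral_comp_emb (MeasurableEquiv.measurableEmbedding _), Measure.volume_eq_prod,
    lintegral_prod]
  · simp_rw [piFinSuccAbove_zero_symm_apply]
  · exact (hF.comp (MeasurableEquiv.measurable _)).aemeasurable

lemma integral_pi_fin_succ {α : Type*} [MeasureSpace α] [SigmaFinite (volume : Measure α)]
    {m : ℕ} (F : (Fin (m + 1) → α) → ℝ) (hF : Integrable F) :
    Integrable (fun q : α × (Fin m → α) => F (Fin.cons q.1 q.2)) ∧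
    ∫ p, F p = ∫ a : α, ∫ p : Fin m → α, F (Fin.cons a p) := by
  have h := volume_preserving_piFinSuccAbove (fun _ : Fin (m + 1) => α) 0
  have hI : Integrable (fun q : α × (Fin m → α) => F (Fin.cons q.1 q.2)) := by
    simp_rw [← piFinSuccAbove_zero_symm_apply]
    exact (h.symm.integrable_comp_emb (MeasurableEquiv.measurableEmbedding _)).2 hF
  refine ⟨hI, ?_⟩
  rw [← h.symm.integral_comp', Measure.volume_eq_prod]
  simp_rw [piFinSuccAbove_zero_symm_apply]
  exact integral_prod _ hI

lemma lintegral_pathDensity_succ {n m : ℕ} (t : ℝ) (x : EuclideanSpace ℝ (Fin n))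
    {F : (Fin (m + 1) → ℝ × EuclideanSpace ℝ (Fin n)) → ENNReal} (hF : Measurable F) :
    ∫⁻ p, ENNReal.ofReal (pathDensity n (m + 1) t x p) * F p =
      ∫⁻ s in Set.Ioo 0 t, ∫⁻ z, ENNReal.ofReal (heatG n (t - s) (x - z)) *
        ∫⁻ p, ENNReal.ofReal (pathDensity n m s z p) * F (Fin.cons (s, z) p) := by
  have hmeas : Measurable fun p => ENNReal.ofReal (pathDensity n (m + 1) t x p) * F p :=
    (measurable_pathDensity_right n (m + 1) t x).ennreal_ofReal.mul hF
  have hcons : Measurable fun q : (ℝ × EuclideanSpace ℝ (Fin n)) ×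
      (Fin m → ℝ × EuclideanSpace ℝ (Fin n)) =>
      (Fin.cons q.1 q.2 : Fin (m + 1) → ℝ × EuclideanSpace ℝ (Fin n)) := by
    simp_rw [← piFinSuccAbove_zero_symm_apply]
    exact MeasurableEquiv.measurable _
  rw [lintegral_pi_fin_succ _ hmeas, Measure.volume_eq_prod, lintegral_prod,
    ← lintegral_indicator measurableSet_Ioo]
  · refine lintegral_congr fun s => ?_
    by_cases hs : s ∈ Set.Ioo 0 t
    · rw [Set.indicator_of_mem hs]
      refine lintegral_congr fun z => ?_
      rw [← lintegral_const_mul]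
      · refine lintegral_congr fun p => ?_
        have h : 0 ≤ heatG n (t - s) (x - z) := heatG_nonneg (by linarith [hs.2]) _
        simp only [pathDensity, Fin.cons_zero, Fin.tail_cons, Set.indicator_of_mem hs]
        rw [ENNReal.ofReal_mul h, mul_assoc]
      · exact (measurable_pathDensity_right n m s z).ennreal_ofReal.mul
          (hF.comp (hcons.comp measurable_prodMk_left))
    · simp [pathDensity, Set.indicator_of_notMem hs]
  · refine Measurable.aemeasurable ?_
    exact Measurable.lintegral_prod_right (hmeas.comp hcons)

lemma lintegral_pathDensity {n : ℕ} (m : ℕ) {t : ℝ} (ht : 0 < t)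
    (x : EuclideanSpace ℝ (Fin n)) :
    ∫⁻ p, ENNReal.ofReal (pathDensity n m t x p) =
      ENNReal.ofReal (t ^ m / m.factorial * heatG n t x) := by
  induction m generalizing t x with
  | zero =>
    simp [pathDensity, lintegral_const, Measure.volume_pi_eq_dirac (0 : Fin 0 → _)]
  | succ m ih =>
    have h1 := lintegral_pathDensity_succ (m := m) t x (F := fun _ => 1) measurable_const
    simp only [mul_one] at h1
    rw [h1]
    have h2 : ∀ s ∈ Set.Ioo 0 t, ∫⁻ z, ENNReal.ofReal (heatG n (t - s) (x - z)) *
        ∫⁻ p, ENNReal.ofReal (pathDensity n m s z p) =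
        ENNReal.ofReal (s ^ m / m.factorial * heatG n t x) := by
      intro s hs
      have hs' : 0 < t - s := by linarith [hs.2]
      have h3 := lintegral_heatG_mul_heatG hs' hs.1 x
      rw [sub_add_cancel] at h3
      have hsm : 0 ≤ s ^ m / m.factorial := div_nonneg (pow_nonneg hs.1.le _) (by positivity)
      rw [ENNReal.ofReal_mul hsm, ← h3, ← lintegral_const_mul']
      · refine lintegral_congr fun z => ?_
        rw [ih hs.1, ENNReal.ofReal_mul hsm, ENNReal.ofReal_mul (heatG_nonneg hs'.le _)]
        ring
      · exact ENNReal.ofReal_ne_top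
    rw [setLIntegral_congr_fun measurableSet_Ioo h2, ← ofReal_integral_eq_lintegral_ofReal]
    · congr 1
      rw [← integral_Ioc_eq_integral_Ioo, ← intervalIntegral.integral_of_le ht.le]
      simp only [intervalIntegral.integral_mul_const, intervalIntegral.integral_div, integral_pow]
      rw [Nat.factorial_succ]
      push_cast
      field_simp
      simp
    · have : Continuous fun s : ℝ => s ^ m / m.factorial * heatG n t x := by fun_prop
      exact (this.integrableOn_Icc (a := 0) (b := t)).mono_set Set.Ioo_subset_Icc_self
    · filter_upwards [ae_restrict_mem measurableSet_Ioo] with s hs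
      exact mul_nonneg (div_nonneg (pow_nonneg hs.1.le _) (by positivity))
        (heatG_nonneg ht.le x)

lemma integrable_pathDensity {n : ℕ} (m : ℕ) {t : ℝ} (ht : 0 < t)
    (x : EuclideanSpace ℝ (Fin n)) : Integrable (pathDensity n m t x) := by
  refine ⟨(measurable_pathDensity_right n m t x).aestronglyMeasurable, ?_⟩
  rw [hasFiniteIntegral_iff_ofReal
    (Filter.Eventually.of_forall fun p => pathDensity_nonneg m ht.le x p),
    lintegral_pathDensity m ht]
  exact ENNReal.ofReal_lt_top

lemma integral_pathDensity {n : ℕ} (m : ℕ) {t : ℝ} (ht : 0 < t)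
    (x : EuclideanSpace ℝ (Fin n)) :
    ∫ p, pathDensity n m t x p = t ^ m / m.factorial * heatG n t x := by
  rw [integral_eq_lintegral_of_nonneg_ae
    (Filter.Eventually.of_forall fun p => pathDensity_nonneg m ht.le x p)
    (measurable_pathDensity_right n m t x).aestronglyMeasurable, lintegral_pathDensity m ht,
    ENNReal.toReal_ofReal]
  exact mul_nonneg (by positivity) (heatG_nonneg ht.le x)

lemma exists_lintegral_pathDensity_moment_le (n m N : ℕ) :
    ∃ C : ℝ, 0 < C ∧ ∀ t ∈ Set.Ioc (0 : ℝ) 1, ∀ x : EuclideanSpace ℝ (Fin n),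
      ∫⁻ p, ENNReal.ofReal (pathDensity n m t x p) *
        ENNReal.ofReal (∏ k, (1 + ‖(p k).2‖) ^ N) ≤
        ENNReal.ofReal (C * heatG n (2 ^ m * t) x) := by
  induction m with
  | zero =>
    refine ⟨1, one_pos, fun t _ x => ?_⟩
    simp [pathDensity, lintegral_const, Measure.volume_pi_eq_dirac (0 : Fin 0 → _)]
  | succ m ih =>
    obtain ⟨C, hC, h⟩ := ih
    obtain ⟨D, hD, h'⟩ := exists_pow_mul_heatG_le n N (2 ^ m)
    set c : ℝ := (2 ^ (m + 1)) ^ ((n : ℝ) / 2) with hc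
    have hc0 : 0 < c := by positivity
    refine ⟨c * (C * D), by positivity, fun t ht x => ?_⟩
    rw [lintegral_pathDensity_succ t x (by fun_prop)]
    have key : ∀ s ∈ Set.Ioo 0 t, ∫⁻ z, ENNReal.ofReal (heatG n (t - s) (x - z)) *
        ∫⁻ p, ENNReal.ofReal (pathDensity n m s z p) *
          ENNReal.ofReal (∏ k, (1 + ‖((Fin.cons (s, z) p :
            Fin (m + 1) → ℝ × EuclideanSpace ℝ (Fin n)) k).2‖) ^ N) ≤
        ENNReal.ofReal (c * (C * D) * heatG n (2 ^ (m + 1) * t) x) := by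
      intro s hs
      have hs1 : s ≤ 1 := hs.2.le.trans ht.2
      have hts : 0 < t - s := by linarith [hs.2]
      have hpos : (0 : ℝ) < 2 ^ (m + 1) * (t - s) := by positivity
      have hpos' : (0 : ℝ) < 2 ^ (m + 1) * s := mul_pos (by positivity) hs.1
      have hcv := lintegral_heatG_mul_heatG hpos hpos' x
      rw [show (2 : ℝ) ^ (m + 1) * (t - s) + 2 ^ (m + 1) * s = 2 ^ (m + 1) * t by ring] at hcv
      rw [ENNReal.ofReal_mul (by positivity), ← hcv, ← lintegral_const_mul' _ _ (by simp)]
      refine lintegral_mono fun z => ?_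
      simp only [Fin.prod_univ_succ, Fin.cons_zero, Fin.cons_succ]
      have e : ∀ p : Fin m → ℝ × EuclideanSpace ℝ (Fin n),
          ENNReal.ofReal (pathDensity n m s z p) *
          ENNReal.ofReal ((1 + ‖z‖) ^ N * ∏ k, (1 + ‖(p k).2‖) ^ N) =
          ENNReal.ofReal ((1 + ‖z‖) ^ N) * (ENNReal.ofReal (pathDensity n m s z p) *
          ENNReal.ofReal (∏ k, (1 + ‖(p k).2‖) ^ N)) := by
        intro p
        rw [ENNReal.ofReal_mul (by positivity)]
        ring
      simp_rw [e]
      rw [lintegral_const_mul' _ _ (by simp)]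
      calc _ ≤ ENNReal.ofReal (heatG n (t - s) (x - z)) * (ENNReal.ofReal ((1 + ‖z‖) ^ N) *
            ENNReal.ofReal (C * heatG n (2 ^ m * s) z)) := by
            gcongr
            exact h s ⟨hs.1, hs1⟩ z
        _ = ENNReal.ofReal (heatG n (t - s) (x - z) * (C * ((1 + ‖z‖) ^ N *
            heatG n (2 ^ m * s) z))) := by
            rw [← ENNReal.ofReal_mul (by positivity),
              ← ENNReal.ofReal_mul (heatG_nonneg hts.le _)]
            ring_nf
        _ ≤ _ := by
            rw [← ENNReal.ofReal_mul (by positivity)]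
            apply ENNReal.ofReal_le_ofReal
            have h1 := heatG_le_heatG_mul (c := 2 ^ (m + 1)) (one_le_pow₀ one_le_two) hts (x - z)
            have h2 := h' (2 ^ m * s) ⟨mul_pos (by positivity) hs.1, by
              have : (0 : ℝ) < 2 ^ m := by positivity
              nlinarith⟩ z
            rw [← mul_assoc 2, ← pow_succ'] at h2
            have h3 := heatG_nonneg hts.le (x - z)
            have h4 := heatG_nonneg hpos'.le z
            have h5 := heatG_nonneg hpos.le (x - z)
            have h6 : 0 ≤ heatG n (2 ^ m * s) z :=
              heatG_nonneg (mul_nonneg (by positivity) hs.1.le) z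
            calc _ ≤ (c * heatG n (2 ^ (m + 1) * (t - s)) (x - z)) *
                  (C * (D * heatG n (2 ^ (m + 1) * s) z)) := by gcongr
              _ = _ := by ring
    calc _ ≤ ∫⁻ s in Set.Ioo 0 t, ENNReal.ofReal (c * (C * D) * heatG n (2 ^ (m + 1) * t) x) :=
          setLIntegral_mono' measurableSet_Ioo key
      _ = ENNReal.ofReal (c * (C * D) * heatG n (2 ^ (m + 1) * t) x) * ENNReal.ofReal t := by
          simp
      _ ≤ ENNReal.ofReal (c * (C * D) * heatG n (2 ^ (m + 1) * t) x) * 1 := by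
          gcongr
          rw [← ENNReal.ofReal_one]
          exact ENNReal.ofReal_le_ofReal ht.2
      _ = _ := mul_one _

/-- Polynomial moments of the path density at time `1`. -/
lemma integrable_pathDensity_mul_moment (n m N : ℕ) :
    Integrable fun p => pathDensity n m 1 0 p * ∏ k, (1 + ‖(p k).2‖) ^ N := by
  obtain ⟨C, -, h⟩ := exists_lintegral_pathDensity_moment_le n m N
  have h0 := pathDensity_nonneg (n := n) m zero_le_one 0
  refine ⟨((measurable_pathDensity_right n m 1 0).mul (by fun_prop)).aestronglyMeasurable, ?_⟩
  rw [hasFiniteIntegral_iff_ofReal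
    (Filter.Eventually.of_forall fun p => mul_nonneg (h0 p) (by positivity))]
  simp_rw [ENNReal.ofReal_mul (h0 _)]
  exact (h 1 ⟨one_pos, le_rfl⟩ 0).trans_lt ENNReal.ofReal_lt_top

/-- A product weight of polynomial growth is integrable against the path density. -/
lemma integrable_pathDensity_mul {n m : ℕ} (N : ℕ) {B : ℝ}
    {F : (Fin m → ℝ × EuclideanSpace ℝ (Fin n)) → ℝ} (hF : Measurable F)
    (hB : ∀ p, |F p| ≤ B * ∏ k, (1 + ‖(p k).2‖) ^ N) :
    Integrable fun p => pathDensity n m 1 0 p * F p := by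
  refine ((integrable_pathDensity_mul_moment n m N).const_mul B).mono'
    ((measurable_pathDensity_right n m 1 0).mul hF).aestronglyMeasurable
    (Filter.Eventually.of_forall fun p => ?_)
  have h0 := pathDensity_nonneg (n := n) m zero_le_one 0 p
  rw [norm_mul, Real.norm_eq_abs, Real.norm_eq_abs, abs_of_nonneg h0]
  calc _ ≤ pathDensity n m 1 0 p * (B * ∏ k, (1 + ‖(p k).2‖) ^ N) := by gcongr; exact hB p
    _ = _ := by ring

lemma Gam_zero_right_eq_integral {n : ℕ} {U : EuclideanSpace ℝ (Fin n) → ℝ} (hU : Measurable U)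
    {B : ℝ} (hB : ∀ z, |U z| ≤ B) (m : ℕ) {t : ℝ} (ht : 0 < t) (x : EuclideanSpace ℝ (Fin n)) :
    Gam n U m t x 0 = (-1) ^ m * ∫ p, pathDensity n m t x p * ∏ k, U (p k).2 := by
  induction m generalizing t x with
  | zero => simp [Gam, pathDensity, integral_const, Measure.volume_pi_eq_dirac (0 : Fin 0 → _)]
  | succ m ih =>
    have hI : Integrable fun p : Fin (m + 1) → ℝ × EuclideanSpace ℝ (Fin n) =>
        pathDensity n (m + 1) t x p * ∏ k, U (p k).2 := by
      refine (integrable_pathDensity (m + 1) ht x).mul_bdd (c := B ^ (m + 1))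
        (by fun_prop : Measurable _).aestronglyMeasurable
        (Filter.Eventually.of_forall fun p => ?_)
      rw [Real.norm_eq_abs, Finset.abs_prod]
      calc _ ≤ ∏ _k : Fin (m + 1), B :=
            Finset.prod_le_prod (fun _ _ => abs_nonneg _) fun k _ => hB _
        _ = _ := by simp
    obtain ⟨hI', hE⟩ := integral_pi_fin_succ _ hI
    rw [hE]
    have hI2 := hI'.integral_prod_left
    rw [Measure.volume_eq_prod, integral_prod _ hI2]
    simp only [Gam]
    rw [pow_succ, mul_assoc, ← integral_const_mul, ← neg_one_mul, ← integral_const_mul,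
      ← integral_const_mul, ← integral_indicator measurableSet_Ioo]
    refine integral_congr_ae (Filter.Eventually.of_forall fun s => ?_)
    dsimp only
    by_cases hs : s ∈ Set.Ioo 0 t
    · rw [Set.indicator_of_mem hs, ← integral_const_mul, ← integral_const_mul, ← integral_const_mul]
      refine integral_congr_ae (Filter.Eventually.of_forall fun z => ?_)
      dsimp only
      rw [ih hs.1]
      simp only [pathDensity, Fin.cons_zero, Fin.tail_cons, Set.indicator_of_mem hs,
        Fin.prod_univ_succ, Fin.cons_succ]
      rw [← integral_const_mul, ← integral_const_mul, ← integral_const_mul, ← integral_const_mul,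
        ← integral_const_mul]
      refine integral_congr_ae (Filter.Eventually.of_forall fun p => ?_)
      dsimp only
      ring
    · simp [pathDensity, Set.indicator_of_notMem hs]

lemma integral_comp_add_smul {n : ℕ} {r : ℝ} (hr : 0 < r) (c : EuclideanSpace ℝ (Fin n))
    (f : EuclideanSpace ℝ (Fin n) → ℝ) :
    ∫ z, f z = r ^ n * ∫ z, f (c + r • z) := by
  have h := Measure.integral_comp_smul (volume : Measure (EuclideanSpace ℝ (Fin n)))
    (fun z => f (c + z)) r
  rw [h, integral_add_left_eq_self f c, finrank_euclideanSpace_fin,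
    abs_of_pos (by positivity : 0 < (r ^ n)⁻¹), smul_eq_mul]
  field_simp

lemma setIntegral_Ioo_mul {a t : ℝ} (ha : 0 < a) (ht : 0 ≤ t) (f : ℝ → ℝ) :
    ∫ s in Set.Ioo 0 (a * t), f s = a * ∫ s in Set.Ioo 0 t, f (a * s) := by
  have h := intervalIntegral.integral_comp_mul_left (a := 0) (b := t) f ha.ne'
  rw [mul_zero, intervalIntegral.integral_of_le ht, intervalIntegral.integral_of_le (by positivity),
    integral_Ioc_eq_integral_Ioo, integral_Ioc_eq_integral_Ioo] at h
  rw [h, smul_eq_mul]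
  field_simp

lemma Gam_rescale {n : ℕ} (V : EuclideanSpace ℝ (Fin n) → ℝ) {r : ℝ} (hr : 0 < r)
    (c : EuclideanSpace ℝ (Fin n)) (m : ℕ) {t : ℝ} (ht : 0 < t)
    (x y : EuclideanSpace ℝ (Fin n)) :
    Gam n V m (r ^ 2 * t) (c + r • x) (c + r • y) =
      r ^ (2 * m) * (r ^ n)⁻¹ * Gam n (fun z => V (c + r • z)) m t x y := by
  induction m generalizing t x y with
  | zero => simp only [Gam]; rw [add_sub_add_left_eq_sub, ← smul_sub, heatG_sq_mul_smul hr ht.le]; simp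
  | succ m ih =>
    simp only [Gam]
    rw [setIntegral_Ioo_mul (by positivity) ht.le, mul_neg, neg_inj, ← integral_const_mul,
      ← integral_const_mul]
    refine setIntegral_congr_fun measurableSet_Ioo fun s hs => ?_
    rw [integral_comp_add_smul hr c, ← mul_assoc, ← integral_const_mul, ← integral_const_mul]
    refine integral_congr_ae (Filter.Eventually.of_forall fun z => ?_)
    dsimp only
    rw [ih hs.1, add_sub_add_left_eq_sub, ← smul_sub, ← mul_sub,
      heatG_sq_mul_smul hr (by linarith [hs.2])]
    field_simp
    ring

lemma pathDensity_succ_eq_indicator {n : ℕ} (m : ℕ) (t : ℝ) (x : EuclideanSpace ℝ (Fin n))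
    (s : Fin (m + 1) → ℝ) (w : Fin (m + 1) → EuclideanSpace ℝ (Fin n)) :
    pathDensity n (m + 1) t x (fun k => (s k, w k)) =
      {s : Fin (m + 1) → ℝ | StrictAnti s ∧ ∀ k, s k ∈ Set.Ioo (0 : ℝ) t}.indicator
        (fun s => heatG n (t - s 0) (x - w 0) *
          ∏ k, heatG n (s k - fnext s k) (w k - fnext w k)) s := by
  induction m generalizing t x with
  | zero =>
    have h : StrictAnti s := fun i j hij => absurd hij (by omega)
    simp [pathDensity, Set.indicator, fnext, h]
  | succ m ih =>
    have h := ih (s 0) (w 0) (Fin.tail s) (Fin.tail w)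
    have hp : ∀ k : Fin (m + 1), heatG n (s k.succ - fnext s k.succ) (w k.succ - fnext w k.succ) =
        heatG n (Fin.tail s k - fnext (Fin.tail s) k) (Fin.tail w k - fnext (Fin.tail w) k) := by
      intro k
      have e : ∀ {F : Type} [Zero F] (f : Fin (m + 1 + 1) → F),
          fnext f k.succ = fnext (Fin.tail f) k := by
        intro F _ f
        simp only [fnext, Fin.val_succ, add_lt_add_iff_right]
        rfl
      rw [e, e]; rfl
    have h0 : ∀ {F : Type} [Zero F] (f : Fin (m + 1 + 1) → F), fnext f 0 = Fin.tail f 0 := by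
      intro F _ f
      simp [fnext, Fin.tail]
    rw [pathDensity]
    simp only [Set.indicator_apply]
    rw [Fin.prod_univ_succ, h0, h0]
    simp_rw [hp]
    have hset : (StrictAnti s ∧ ∀ k, s k ∈ Set.Ioo (0 : ℝ) t) ↔ s 0 ∈ Set.Ioo 0 t ∧
        (StrictAnti (Fin.tail s) ∧ ∀ k, Fin.tail s k ∈ Set.Ioo (0 : ℝ) (s 0)) := by
      constructor
      · rintro ⟨h1, h2⟩
        exact ⟨h2 0, h1.comp_strictMono (Fin.strictMono_succ),
          fun k => ⟨(h2 _).1, h1 (Fin.succ_pos k)⟩⟩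
      · rintro ⟨h1, h2, h3⟩
        constructor
        · intro i j hij
          induction i using Fin.cases with
          | zero =>
            induction j using Fin.cases with
            | zero => exact absurd hij (lt_irrefl _)
            | succ j => exact (h3 j).2
          | succ i =>
            induction j using Fin.cases with
            | zero => exact absurd hij (by simp)
            | succ j => exact h2 (Fin.succ_lt_succ_iff.1 hij)
        · intro k
          induction k using Fin.cases with
          | zero => exact h1
          | succ k => exact ⟨(h3 k).1, (h3 k).2.trans h1.2⟩
    have ht : (Fin.tail fun k => (s k, w k)) = fun k => (Fin.tail s k, Fin.tail w k) := rfl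
    rw [ht, h, Set.indicator_apply]
    by_cases h1 : s 0 ∈ Set.Ioo 0 t
    · by_cases h2 : (StrictAnti (Fin.tail s) ∧ ∀ k, Fin.tail s k ∈ Set.Ioo (0 : ℝ) (s 0))
      · have h3 : s ∈ {s : Fin (m + 1 + 1) → ℝ | StrictAnti s ∧ ∀ k, s k ∈ Set.Ioo (0 : ℝ) t} :=
          hset.2 ⟨h1, h2⟩
        have h4 : Fin.tail s ∈ {a : Fin (m + 1) → ℝ |
          StrictAnti a ∧ ∀ k, a k ∈ Set.Ioo (0 : ℝ) (s 0)} := h2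
        rw [if_pos h1, if_pos h3, if_pos h4]
      · have h3 : s ∉ {s : Fin (m + 1 + 1) → ℝ | StrictAnti s ∧ ∀ k, s k ∈ Set.Ioo (0 : ℝ) t} :=
          fun h => h2 (hset.1 h).2
        have h4 : Fin.tail s ∉ {a : Fin (m + 1) → ℝ |
          StrictAnti a ∧ ∀ k, a k ∈ Set.Ioo (0 : ℝ) (s 0)} := h2
        rw [if_pos h1, if_neg h3, if_neg h4, mul_zero]
    · have h3 : s ∉ {s : Fin (m + 1 + 1) → ℝ | StrictAnti s ∧ ∀ k, s k ∈ Set.Ioo (0 : ℝ) t} :=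
        fun h => h1 (hset.1 h).1
      rw [if_neg h1, if_neg h3]

lemma measurableSet_simplex (m : ℕ) : MeasurableSet (simplex m) := by
  unfold simplex StrictAnti
  simp only [Set.ofPred_and, Set.ofPred_forall]
  refine MeasurableSet.inter ?_ ?_
  · exact MeasurableSet.iInter fun i => MeasurableSet.iInter fun j => MeasurableSet.iInter fun _ =>
      measurableSet_lt (measurable_pi_apply j) (measurable_pi_apply i)
  · exact MeasurableSet.iInter fun i => measurableSet_Ioo.preimage (measurable_pi_apply i)

lemma integral_pathDensity_mul_eq {n m : ℕ} (F : (Fin (m + 1) → EuclideanSpace ℝ (Fin n)) → ℝ)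
    (hF : Integrable fun p => pathDensity n (m + 1) 1 0 p * F fun k => (p k).2) :
    ∫ p, pathDensity n (m + 1) 1 0 p * F (fun k => (p k).2) =
      ∫ w : Fin (m + 1) → EuclideanSpace ℝ (Fin n), ∫ s in simplex (m + 1),
        F w * (heatG n (1 - s 0) (w 0) * ∏ k, heatG n (s k - fnext s k) (w k - fnext w k)) := by
  have hmp := volume_measurePreserving_arrowProdEquivProdArrow ℝ (EuclideanSpace ℝ (Fin n))
    (Fin (m + 1))
  have hI := (hmp.symm.integrable_comp_emb (MeasurableEquiv.measurableEmbedding _)).2 hF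
  rw [← hmp.symm.integral_comp', Measure.volume_eq_prod]
  refine (integral_prod_symm _ hI).trans ?_
  refine integral_congr_ae (Filter.Eventually.of_forall fun w => ?_)
  dsimp only
  rw [← integral_indicator (measurableSet_simplex _)]
  refine integral_congr_ae (Filter.Eventually.of_forall fun s => ?_)
  have e : (MeasurableEquiv.arrowProdEquivProdArrow ℝ (EuclideanSpace ℝ (Fin n))
    (Fin (m + 1))).symm (s, w) = fun k => (s k, w k) := rfl
  dsimp only
  rw [Function.comp_apply, e, pathDensity_succ_eq_indicator]
  change (simplex (m + 1)).indicator _ s * _ = _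
  by_cases hs : s ∈ simplex (m + 1)
  · rw [Set.indicator_of_mem hs, Set.indicator_of_mem hs, zero_sub, heatG_neg, mul_comm]
  · simp [Set.indicator_of_notMem hs]

lemma abs_apply_le_one_add_norm {n : ℕ} (w : EuclideanSpace ℝ (Fin n)) (i : Fin n) :
    |w i| ≤ 1 + ‖w‖ := by
  have := PiLp.norm_apply_le w i
  rw [Real.norm_eq_abs] at this
  linarith

lemma abs_prod_pow_le {n : ℕ} (w : EuclideanSpace ℝ (Fin n)) (a : Fin n → ℕ) :
    |∏ i, w i ^ a i| ≤ (1 + ‖w‖) ^ ∑ i, a i := by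
  rw [Finset.abs_prod, ← Finset.prod_pow_eq_pow_sum]
  refine Finset.prod_le_prod (fun _ _ => abs_nonneg _) fun i _ => ?_
  rw [abs_pow]
  gcongr
  exact abs_apply_le_one_add_norm w i

lemma integrable_pathDensity_mul_monomial {n m : ℕ} (α : Fin m → Fin n → ℕ) :
    Integrable fun p => pathDensity n m 1 0 p * ∏ k, ∏ i, (p k).2 i ^ α k i := by
  refine integrable_pathDensity_mul (∑ k, ∑ i, α k i) (B := 1) (by fun_prop) fun p => ?_
  rw [one_mul, Finset.abs_prod]
  refine Finset.prod_le_prod (fun _ _ => abs_nonneg _) fun k _ => ?_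
  refine (abs_prod_pow_le _ _).trans (pow_le_pow_right₀ (by simp) ?_)
  exact Finset.single_le_sum (f := fun k => ∑ i, α k i) (fun _ _ => Nat.zero_le _)
    (Finset.mem_univ k)

lemma cCoeff_eq_integral_pathDensity (n m : ℕ) (α : Fin (m + 1) → Fin n → ℕ) :
    cCoeff n m α = (∏ k, ∏ i, (Nat.factorial (α k i) : ℝ))⁻¹ *
      ∫ p, pathDensity n (m + 1) 1 0 p * ∏ k, ∏ i, (p k).2 i ^ α k i := by
  rw [cCoeff, integral_pathDensity_mul_eq (fun w => ∏ k, ∏ i, w k i ^ α k i)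
    (integrable_pathDensity_mul_monomial α)]

lemma cCoeff_eq_zero_of_odd (n m : ℕ) (α : Fin (m + 1) → Fin n → ℕ)
    (h : Odd (∑ k, ∑ i, α k i)) : cCoeff n m α = 0 := by
  rw [cCoeff]
  set I : (Fin (m + 1) → EuclideanSpace ℝ (Fin n)) → ℝ := fun w => ∫ s in simplex (m + 1),
        (∏ k, ∏ i, w k i ^ α k i) *
          (heatG n (1 - s 0) (w 0) *
            ∏ k, heatG n (s k - fnext s k) (w k - fnext w k)) with hI
  have hneg : ∀ w, I (-w) = -I w := by
    intro w
    simp only [hI]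
    rw [← integral_neg]
    congr 1 with s
    have h1 : (∏ k, ∏ i, (-w) k i ^ α k i) = -∏ k, ∏ i, w k i ^ α k i := by
      simp only [Pi.neg_apply, PiLp.neg_apply, neg_pow (w _ _), Finset.prod_mul_distrib,
        Finset.prod_pow_eq_pow_sum, h.neg_one_pow, neg_mul, one_mul]
    have h2 : ∀ k, (-w) k - fnext (-w) k = -(w k - fnext w k) := by
      intro k
      unfold fnext
      split_ifs <;> simp [sub_eq_add_neg, add_comm]
    simp_rw [h1, h2, heatG_neg, Pi.neg_apply, heatG_neg, neg_mul]
  have : ∫ w, I w = -∫ w, I w := by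
    have h1 := Measure.integral_comp_smul
      (volume : Measure (Fin (m + 1) → EuclideanSpace ℝ (Fin n))) I (-1)
    simp only [neg_smul, one_smul, hneg, integral_neg] at h1
    rw [h1, abs_inv, abs_pow, abs_neg, abs_one, one_pow, inv_one, one_smul]
  have h0 : ∫ w, I w = 0 := by linarith
  rw [h0, mul_zero]

/-- Directional derivative along a fixed vector. -/
noncomputable def dirDeriv {X : Type*} [NormedAddCommGroup X] [NormedSpace ℝ X] (e : X)
    (f : X → ℝ) : X → ℝ :=
  fun x => fderiv ℝ f x e

/-- Iterated directional derivatives along a tuple of vectors. -/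
noncomputable def multiDirDeriv {X : Type*} [NormedAddCommGroup X] [NormedSpace ℝ X] {k : ℕ}
    (e : Fin k → X) (α : Fin k → ℕ) (f : X → ℝ) : X → ℝ :=
  ((List.ofFn fun i : Fin k => (dirDeriv (e i))^[α i]).foldr (· ∘ ·) id) f

/-- Smooth functions with support in a fixed set. -/
def SmoothSupportedIn {X : Type*} [NormedAddCommGroup X] [NormedSpace ℝ X] (S : Set X)
    (f : X → ℝ) : Prop :=
  ContDiff ℝ (⊤ : ℕ∞) f ∧ tsupport f ⊆ S

section

variable {X : Type*} [NormedAddCommGroup X] [NormedSpace ℝ X] {S : Set X} {f : X → ℝ}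

lemma SmoothSupportedIn.dirDeriv (hf : SmoothSupportedIn S f) (e : X) :
    SmoothSupportedIn S (dirDeriv e f) := by
  refine ⟨(hf.1.fderiv_right (m := (⊤ : ℕ∞)) (by simp)).clm_apply contDiff_const, ?_⟩
  refine (closure_mono fun x hx => ?_).trans ((tsupport_fderiv_subset ℝ (f := f)).trans hf.2)
  rw [Function.mem_support] at hx ⊢
  intro h
  exact hx (by simp [_root_.dirDeriv, h])

lemma SmoothSupportedIn.iterate_dirDeriv (hf : SmoothSupportedIn S f) (e : X) (a : ℕ) :
    SmoothSupportedIn S ((_root_.dirDeriv e)^[a] f) := by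
  induction a with
  | zero => exact hf
  | succ a ih => rw [Function.iterate_succ_apply']; exact ih.dirDeriv e

lemma multiDirDeriv_succ {k : ℕ} (e : Fin (k + 1) → X) (α : Fin (k + 1) → ℕ) (f : X → ℝ) :
    multiDirDeriv e α f =
      (dirDeriv (e 0))^[α 0] (multiDirDeriv (Fin.tail e) (Fin.tail α) f) := by
  simp only [multiDirDeriv, List.ofFn_succ, List.foldr_cons, Function.comp_apply]
  rfl

lemma SmoothSupportedIn.multiDirDeriv (hf : SmoothSupportedIn S f) {k : ℕ} (e : Fin k → X)
    (α : Fin k → ℕ) : SmoothSupportedIn S (multiDirDeriv e α f) := by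
  induction k with
  | zero => simpa [_root_.multiDirDeriv] using hf
  | succ k ih =>
    rw [multiDirDeriv_succ]
    exact (ih _ _).iterate_dirDeriv _ _

lemma SmoothSupportedIn.eq_zero (hf : SmoothSupportedIn S f) {x : X} (hx : x ∉ S) : f x = 0 :=
  image_eq_zero_of_notMem_tsupport fun h => hx (hf.2 h)

lemma SmoothSupportedIn.exists_abs_le (hS : IsCompact S) (hf : SmoothSupportedIn S f) :
    ∃ C : ℝ, 0 ≤ C ∧ ∀ x, |f x| ≤ C := by
  have hc : HasCompactSupport f := hS.of_isClosed_subset (isClosed_tsupport f) hf.2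
  obtain ⟨C, hC⟩ := hc.exists_bound_of_continuous hf.1.continuous
  exact ⟨C, (norm_nonneg _).trans (hC 0), hC⟩

lemma SmoothSupportedIn.exists_taylor_bound (hS : IsCompact S) (hf : SmoothSupportedIn S f)
    (e : X) (K : ℕ) :
    ∃ C : ℝ, 0 ≤ C ∧ ∀ x (r : ℝ), |f (x + r • e) -
      ∑ a ∈ Finset.range K, r ^ a / a.factorial * (_root_.dirDeriv e)^[a] f x| ≤ C * |r| ^ K := by
  induction K generalizing f with
  | zero =>
    obtain ⟨C, hC, h⟩ := hf.exists_abs_le hS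
    exact ⟨C, hC, fun x r => by simpa using h _⟩
  | succ K ih =>
    obtain ⟨C, hC, h⟩ := ih (hf.dirDeriv e)
    refine ⟨C, hC, fun x r => ?_⟩
    set φ : ℝ → ℝ := fun r => f (x + r • e) -
      ∑ a ∈ Finset.range (K + 1), r ^ a / a.factorial * (_root_.dirDeriv e)^[a] f x with hφ
    have hd : ∀ s, HasDerivAt φ (_root_.dirDeriv e f (x + s • e) -
        ∑ a ∈ Finset.range K, s ^ a / a.factorial *
          (_root_.dirDeriv e)^[a] (_root_.dirDeriv e f) x) s := by
      intro s
      refine HasDerivAt.sub ?_ ?_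
      · have h1 : HasDerivAt (fun s : ℝ => x + s • e) e s := by
          simpa using ((hasDerivAt_id s).smul_const e).const_add x
        have h2 := (hf.1.differentiable (by simp) (x + s • e)).hasFDerivAt
        exact h2.comp_hasDerivAt s h1
      · simp_rw [Finset.sum_range_succ', pow_zero]
        have h3 : ∀ a ∈ Finset.range K, HasDerivAt (fun s : ℝ => s ^ (a + 1) /
            (a + 1).factorial * (_root_.dirDeriv e)^[a + 1] f x) (s ^ a / a.factorial *
            (_root_.dirDeriv e)^[a] (_root_.dirDeriv e f) x) s := by
          intro a _
          rw [Function.iterate_succ_apply]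
          refine HasDerivAt.mul_const ?_ _
          refine ((hasDerivAt_pow (a + 1) s).div_const _).congr_deriv ?_
          rw [Nat.factorial_succ]
          push_cast
          field_simp
        exact (HasDerivAt.fun_sum h3).add_const _
    have h0 : φ 0 = 0 := by
      simp [hφ, Finset.sum_range_succ']
    have key := (convex_Icc (-|r|) |r|).norm_image_sub_le_of_norm_hasDerivWithin_le
      (f := φ) (C := C * |r| ^ K) (fun s _ => (hd s).hasDerivWithinAt) (fun s hs => ?_)
      (x := 0) (y := r) (by simp) ⟨neg_abs_le r, le_abs_self r⟩
    · rw [h0, sub_zero, sub_zero, Real.norm_eq_abs, Real.norm_eq_abs] at key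
      rw [pow_succ, ← mul_assoc]
      exact key
    · refine (h x s).trans ?_
      exact mul_le_mul_of_nonneg_left (pow_le_pow_left₀ (abs_nonneg _) (abs_le.2 hs) _) hC

/-- The Taylor polynomial in which each variable has degree `< K`. -/
noncomputable def boxTaylor {k : ℕ} (K : ℕ) (e : Fin k → X) (f : X → ℝ) (x : X)
    (u : Fin k → ℝ) : ℝ :=
  ∑ α : Fin k → Fin K, (∏ i, u i ^ (α i : ℕ) / (α i : ℕ).factorial) *
    multiDirDeriv e (fun i => (α i : ℕ)) f x

lemma abs_prod_pow_div_factorial_le {k K : ℕ} (α : Fin k → Fin K) {u : Fin k → ℝ} {ρ : ℝ}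
    (hu : ∀ i, |u i| ≤ ρ) (hρ : 0 ≤ ρ) :
    |∏ i, u i ^ (α i : ℕ) / (α i : ℕ).factorial| ≤ (1 + ρ) ^ (K * k) := by
  rw [Finset.abs_prod, pow_mul]
  calc _ ≤ ∏ _i : Fin k, (1 + ρ) ^ K := by
        refine Finset.prod_le_prod (fun _ _ => abs_nonneg _) fun i _ => ?_
        rw [abs_div, abs_pow, Nat.abs_cast]
        have h1 : (1 : ℝ) ≤ (α i : ℕ).factorial := by
          exact_mod_cast Nat.one_le_iff_ne_zero.2 (Nat.factorial_ne_zero _)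
        calc _ ≤ |u i| ^ (α i : ℕ) := div_le_self (by positivity) h1
          _ ≤ (1 + ρ) ^ (α i : ℕ) := by gcongr; linarith [hu i]
          _ ≤ _ := pow_le_pow_right₀ (by linarith) (α i).2.le
    _ = _ := by simp

lemma boxTaylor_succ {k : ℕ} (K : ℕ) (e : Fin (k + 1) → X) (f : X → ℝ) (x : X)
    (u : Fin (k + 1) → ℝ) :
    boxTaylor K e f x u = ∑ α : Fin k → Fin K,
      (∏ i, Fin.tail u i ^ (α i : ℕ) / (α i : ℕ).factorial) *
        ∑ a ∈ Finset.range K, u 0 ^ a / a.factorial *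
          (dirDeriv (e 0))^[a] (multiDirDeriv (Fin.tail e) (fun i => (α i : ℕ)) f) x := by
  rw [boxTaylor, ← (Fin.consEquiv fun _ => Fin K).sum_comp, Fintype.sum_prod_type_right]
  refine Finset.sum_congr rfl fun α _ => ?_
  rw [← Fin.sum_univ_eq_sum_range (fun a => u 0 ^ a / a.factorial *
          (dirDeriv (e 0))^[a] (multiDirDeriv (Fin.tail e) (fun i => (α i : ℕ)) f) x),
    Finset.mul_sum]
  refine Finset.sum_congr rfl fun a _ => ?_
  rw [Fin.prod_univ_succ, multiDirDeriv_succ]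
  simp only [Fin.consEquiv_apply, Fin.cons_zero, Fin.cons_succ]
  have h : (Fin.tail fun i => (((Fin.cons a α : Fin (k + 1) → Fin K) i : Fin K) : ℕ)) =
      fun i => (α i : ℕ) := by
    ext i; simp [Fin.tail]
  rw [h]
  simp only [Fin.tail]
  ring

lemma SmoothSupportedIn.exists_boxTaylor_bound (hS : IsCompact S) (hf : SmoothSupportedIn S f)
    (K : ℕ) {k : ℕ} (e : Fin k → X) :
    ∃ (C : ℝ) (M : ℕ), 0 ≤ C ∧ ∀ x (u : Fin k → ℝ) (ρ : ℝ), (∀ i, |u i| ≤ ρ) → 0 ≤ ρ →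
      |f (x + ∑ i, u i • e i) - boxTaylor K e f x u| ≤ C * (ρ ^ K * (1 + ρ) ^ M) := by
  induction k with
  | zero =>
    refine ⟨0, 0, le_rfl, fun x u ρ _ _ => ?_⟩
    simp [boxTaylor, _root_.multiDirDeriv]
  | succ k ih =>
    obtain ⟨C, M, hC, h⟩ := ih (Fin.tail e)
    have hα : ∀ α : Fin k → Fin K, ∃ C : ℝ, 0 ≤ C ∧ ∀ x (r : ℝ),
        |_root_.multiDirDeriv (Fin.tail e) (fun i => (α i : ℕ)) f (x + r • e 0) -
          ∑ a ∈ Finset.range K, r ^ a / a.factorial * (_root_.dirDeriv (e 0))^[a]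
            (_root_.multiDirDeriv (Fin.tail e) (fun i => (α i : ℕ)) f) x| ≤ C * |r| ^ K :=
      fun α => (hf.multiDirDeriv (Fin.tail e) _).exists_taylor_bound hS (e 0) K
    choose D hD hD' using hα
    refine ⟨C + ∑ α, D α, M + K * k, add_nonneg hC (Finset.sum_nonneg fun α _ => hD α),
      fun x u ρ hu hρ => ?_⟩
    have h1 := h (x + u 0 • e 0) (Fin.tail u) ρ (fun i => hu i.succ) hρ
    have e1 : x + ∑ i, u i • e i = x + u 0 • e 0 + ∑ i, Fin.tail u i • Fin.tail e i := by
      rw [Fin.sum_univ_succ, add_assoc]; rfl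
    have h2 : |boxTaylor K (Fin.tail e) f (x + u 0 • e 0) (Fin.tail u) - boxTaylor K e f x u| ≤
        (∑ α, D α) * (ρ ^ K * (1 + ρ) ^ (K * k)) := by
      rw [boxTaylor_succ, boxTaylor, ← Finset.sum_sub_distrib, Finset.sum_mul]
      refine (Finset.abs_sum_le_sum_abs _ _).trans (Finset.sum_le_sum fun α _ => ?_)
      rw [← mul_sub, abs_mul]
      have h3 := abs_prod_pow_div_factorial_le α (u := Fin.tail u) (fun i => hu i.succ) hρ
      have h4 := hD' α x (u 0)
      have h5 : D α * |u 0| ^ K ≤ D α * ρ ^ K := by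
        have := hD α
        have := hu 0
        gcongr
      calc _ ≤ (1 + ρ) ^ (K * k) * (D α * ρ ^ K) :=
            mul_le_mul h3 (h4.trans h5) (abs_nonneg _) (by positivity)
        _ = _ := by ring
    have h6 : (1 + ρ) ^ M ≤ (1 + ρ) ^ (M + K * k) :=
      pow_le_pow_right₀ (by linarith) (Nat.le_add_right _ _)
    have h7 : (1 + ρ) ^ (K * k) ≤ (1 + ρ) ^ (M + K * k) :=
      pow_le_pow_right₀ (by linarith) (Nat.le_add_left _ _)
    have hDs : 0 ≤ ∑ α, D α := Finset.sum_nonneg fun α _ => hD α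
    rw [e1]
    calc _ ≤ _ := abs_sub_le _ (boxTaylor K (Fin.tail e) f (x + u 0 • e 0) (Fin.tail u)) _
      _ ≤ C * (ρ ^ K * (1 + ρ) ^ M) + (∑ α, D α) * (ρ ^ K * (1 + ρ) ^ (K * k)) := add_le_add h1 h2
      _ ≤ C * (ρ ^ K * (1 + ρ) ^ (M + K * k)) +
          (∑ α, D α) * (ρ ^ K * (1 + ρ) ^ (M + K * k)) := by gcongr
      _ = _ := by ring

lemma SmoothSupportedIn.boxTaylor_eq_zero (hf : SmoothSupportedIn S f) (K : ℕ) {k : ℕ}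
    (e : Fin k → X) {x : X} (hx : x ∉ S) (u : Fin k → ℝ) : boxTaylor K e f x u = 0 := by
  refine Finset.sum_eq_zero fun α _ => ?_
  rw [(hf.multiDirDeriv e _).eq_zero hx, mul_zero]

lemma SmoothSupportedIn.continuous_boxTaylor (hf : SmoothSupportedIn S f) (K : ℕ) {k : ℕ}
    (e : Fin k → X) : Continuous fun q : X × (Fin k → ℝ) => boxTaylor K e f q.1 q.2 := by
  unfold boxTaylor
  refine continuous_finsetSum _ fun α _ => Continuous.mul ?_ ?_
  · fun_prop
  · exact (hf.multiDirDeriv e _).1.continuous.comp continuous_fst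

lemma SmoothSupportedIn.exists_abs_boxTaylor_le (hS : IsCompact S) (hf : SmoothSupportedIn S f)
    (K : ℕ) {k : ℕ} (e : Fin k → X) :
    ∃ C : ℝ, 0 ≤ C ∧ ∀ x (u : Fin k → ℝ) (ρ : ℝ), (∀ i, |u i| ≤ ρ) → 0 ≤ ρ →
      |boxTaylor K e f x u| ≤ C * (1 + ρ) ^ (K * k) := by
  have hα : ∀ α : Fin k → Fin K, ∃ C : ℝ, 0 ≤ C ∧ ∀ x,
      |_root_.multiDirDeriv e (fun i => (α i : ℕ)) f x| ≤ C :=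
    fun α => (hf.multiDirDeriv e _).exists_abs_le hS
  choose D hD hD' using hα
  refine ⟨∑ α, D α, Finset.sum_nonneg fun α _ => hD α, fun x u ρ hu hρ => ?_⟩
  rw [boxTaylor, Finset.sum_mul]
  refine (Finset.abs_sum_le_sum_abs _ _).trans (Finset.sum_le_sum fun α _ => ?_)
  rw [abs_mul, mul_comm]
  exact mul_le_mul (hD' α x) (abs_prod_pow_div_factorial_le α hu hρ) (abs_nonneg _) (hD α)

end

lemma mderiv_eq_multiDirDeriv {n : ℕ} (α : Fin n → ℕ) (f : EuclideanSpace ℝ (Fin n) → ℝ) :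
    mderiv α f = multiDirDeriv (fun i => EuclideanSpace.single i (1 : ℝ)) α f := rfl

lemma integrable_mul_comp_add {n m : ℕ} {ω : (Fin m → ℝ × EuclideanSpace ℝ (Fin n)) → ℝ}
    (hω : Integrable ω) (hωm : Measurable ω) {ψ : EuclideanSpace ℝ (Fin n) → ℝ}
    (hψ : Integrable ψ) (hψm : Measurable ψ)
    {a : (Fin m → ℝ × EuclideanSpace ℝ (Fin n)) → EuclideanSpace ℝ (Fin n)} (ha : Measurable a) :
    Integrable (fun q : EuclideanSpace ℝ (Fin n) × (Fin m → ℝ × EuclideanSpace ℝ (Fin n)) =>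
      ω q.2 * ψ (q.1 + a q.2)) (volume.prod volume) ∧
    ∫ q : EuclideanSpace ℝ (Fin n) × (Fin m → ℝ × EuclideanSpace ℝ (Fin n)),
      ω q.2 * ψ (q.1 + a q.2) ∂(volume.prod volume) = (∫ p, ω p) * ∫ x, ψ x := by
  have hI : Integrable (fun q : EuclideanSpace ℝ (Fin n) ×
      (Fin m → ℝ × EuclideanSpace ℝ (Fin n)) => ω q.2 * ψ (q.1 + a q.2))
      (volume.prod volume) := by
    refine (integrable_prod_iff' (Measurable.aestronglyMeasurable (by fun_prop))).2 ⟨?_, ?_⟩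
    · exact Filter.Eventually.of_forall fun p => (hψ.comp_add_right (a p)).const_mul (ω p)
    · have e : ∀ p, ∫ x, ‖ω p * ψ (x + a p)‖ = ‖ω p‖ * ∫ x, ‖ψ x‖ := by
        intro p
        simp_rw [norm_mul]
        rw [integral_const_mul, integral_add_right_eq_self fun x => ‖ψ x‖]
      simp_rw [e]
      exact hω.norm.mul_const _
  refine ⟨hI, ?_⟩
  rw [integral_prod_symm _ hI, ← integral_mul_const]
  refine integral_congr_ae (Filter.Eventually.of_forall fun p => ?_)
  dsimp only
  rw [integral_const_mul, integral_add_right_eq_self ψ]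

lemma abs_integral_integral_le {n m : ℕ}
    {f g : EuclideanSpace ℝ (Fin n) × (Fin m → ℝ × EuclideanSpace ℝ (Fin n)) → ℝ}
    (hf : Measurable f) (hg : Integrable g (volume.prod volume)) (h : ∀ q, |f q| ≤ g q) :
    Integrable f (volume.prod volume) ∧
      |∫ x, ∫ p, f (x, p)| ≤ ∫ q, g q ∂(volume.prod volume) := by
  have hI : Integrable f (volume.prod volume) :=
    hg.mono' hf.aestronglyMeasurable (Filter.Eventually.of_forall h)
  refine ⟨hI, ?_⟩
  rw [← integral_prod f hI]
  exact norm_integral_le_of_norm_le (f := f) hg (Filter.Eventually.of_forall h)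

lemma abs_prod_sub_prod_le {m : ℕ} (a b A : Fin m → ℝ) (hA : ∀ k, 1 ≤ A k)
    (ha : ∀ k, |a k| ≤ A k) (hb : ∀ k, |b k| ≤ A k) :
    |∏ k, a k - ∏ k, b k| ≤ (∏ k, A k) * ∑ k, |a k - b k| := by
  induction m with
  | zero => simp
  | succ m ih =>
    simp only [Fin.prod_univ_succ, Fin.sum_univ_succ]
    have h := ih (fun k => a k.succ) (fun k => b k.succ) (fun k => A k.succ) (fun k => hA _)
      (fun k => ha _) (fun k => hb _)
    have h1 : |∏ k : Fin m, a k.succ| ≤ ∏ k : Fin m, A k.succ := by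
      rw [Finset.abs_prod]
      exact Finset.prod_le_prod (fun _ _ => abs_nonneg _) fun k _ => ha _
    have h0 : 0 ≤ ∏ k : Fin m, A k.succ := (abs_nonneg _).trans h1
    have e : a 0 * ∏ k : Fin m, a k.succ - b 0 * ∏ k : Fin m, b k.succ =
        (a 0 - b 0) * ∏ k : Fin m, a k.succ +
          b 0 * (∏ k : Fin m, a k.succ - ∏ k : Fin m, b k.succ) := by ring
    rw [e]
    calc _ ≤ _ := abs_add_le _ _
      _ = |a 0 - b 0| * |∏ k : Fin m, a k.succ| +
          |b 0| * |∏ k : Fin m, a k.succ - ∏ k : Fin m, b k.succ| := by rw [abs_mul, abs_mul]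
      _ ≤ |a 0 - b 0| * (A 0 * ∏ k : Fin m, A k.succ) +
          A 0 * ((∏ k : Fin m, A k.succ) * ∑ k : Fin m, |a k.succ - b k.succ|) := by
          refine add_le_add (mul_le_mul_of_nonneg_left
            (h1.trans (le_mul_of_one_le_left h0 (hA 0))) (abs_nonneg _)) ?_
          exact mul_le_mul (hb 0) h (abs_nonneg _) (by linarith [hA 0])
      _ = _ := by ring

section

variable {n : ℕ} {V : EuclideanSpace ℝ (Fin n) → ℝ}

/-- The rescaled trace of the `m`-th iterated kernel, before integration in space. -/
noncomputable def traceDensity (V : EuclideanSpace ℝ (Fin n) → ℝ) (m : ℕ) (r : ℝ)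
    (x : EuclideanSpace ℝ (Fin n)) : ℝ :=
  ∫ p, pathDensity n m 1 0 p * ∏ k, V (x + r • (p k).2)

lemma Gam_diag_eq_traceDensity (hV : Measurable V) {B : ℝ} (hB : ∀ z, |V z| ≤ B) (m : ℕ) {r : ℝ}
    (hr : 0 < r) (x : EuclideanSpace ℝ (Fin n)) :
    Gam n V m (r ^ 2) x x = (-1) ^ m * (r ^ (2 * m) * (r ^ n)⁻¹) * traceDensity V m r x := by
  have h := Gam_rescale V hr x m one_pos 0 0
  rw [smul_zero, add_zero, mul_one, Gam_zero_right_eq_integral (by fun_prop) (fun z => hB _) m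
    one_pos] at h
  rw [h, traceDensity]
  ring

lemma traceDensity_bound (hV : Continuous V) (hVi : Integrable V) {B : ℝ} (hB : ∀ z, |V z| ≤ B)
    (m : ℕ) (r : ℝ) :
    Integrable (traceDensity V (m + 1) r) ∧
    |∫ x, traceDensity V (m + 1) r x| ≤
      heatG n 1 0 * (∫ x, |V x|) * (B ^ m / (m + 1).factorial) := by
  have hVm := hV.measurable
  obtain ⟨h1, h2⟩ := integrable_mul_comp_add
    (ω := fun p => pathDensity n (m + 1) 1 0 p * B ^ m)
    ((integrable_pathDensity (m + 1) one_pos 0).mul_const _)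
    ((measurable_pathDensity_right n (m + 1) 1 0).mul_const _) hVi.abs (by fun_prop)
    (a := fun p => r • (p 0).2) (by fun_prop)
  obtain ⟨h3, h4⟩ := abs_integral_integral_le (f := fun q => pathDensity n (m + 1) 1 0 q.2 *
    ∏ k, V (q.1 + r • (q.2 k).2))
    (((measurable_pathDensity_right n (m + 1) 1 0).comp measurable_snd).mul (by fun_prop)) h1
    (fun q => by
      have h0 := pathDensity_nonneg (n := n) (m + 1) zero_le_one 0 q.2
      have hb : ∏ k : Fin m, |V (q.1 + r • (q.2 k.succ).2)| ≤ B ^ m := by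
        calc _ ≤ ∏ _k : Fin m, B :=
              Finset.prod_le_prod (fun _ _ => abs_nonneg _) fun k _ => hB _
          _ = _ := by simp
      rw [abs_mul, abs_of_nonneg h0, Finset.abs_prod, Fin.prod_univ_succ, mul_assoc,
        mul_comm (B ^ m)]
      gcongr)
  refine ⟨h3.integral_prod_left, h4.trans_eq ?_⟩
  rw [h2, integral_mul_const, integral_pathDensity _ one_pos, one_pow]
  ring

lemma eq_sum_smul_single (u : EuclideanSpace ℝ (Fin n)) :
    u = ∑ i, u i • EuclideanSpace.single i (1 : ℝ) := by
  have := (EuclideanSpace.basisFun (Fin n) ℝ).sum_repr u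
  simpa using this.symm

lemma prod_boxTaylor_smul {m : ℕ} (K : ℕ) (r : ℝ) (x : EuclideanSpace ℝ (Fin n))
    (p : Fin m → ℝ × EuclideanSpace ℝ (Fin n)) :
    ∏ k, boxTaylor K (fun i => EuclideanSpace.single i (1 : ℝ)) V x (fun i => r * (p k).2 i) =
      ∑ α : Fin m → Fin n → Fin K, (r ^ (∑ k, ∑ i, (α k i : ℕ)) *
        (∏ k, ∏ i, (Nat.factorial (α k i : ℕ) : ℝ))⁻¹ * ∏ k, mderiv (fun i => (α k i : ℕ)) V x) *
          ∏ k, ∏ i, (p k).2 i ^ (α k i : ℕ) := by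
  unfold boxTaylor
  rw [Fintype.prod_sum]
  refine Finset.sum_congr rfl fun α _ => ?_
  simp only [mul_pow, Finset.prod_mul_distrib, Finset.prod_div_distrib,
    Finset.prod_pow_eq_pow_sum, ← mderiv_eq_multiDirDeriv]
  rw [div_eq_mul_inv]
  ring

lemma integral_pathDensity_mul_prod_boxTaylor (m K : ℕ) (r : ℝ) (x : EuclideanSpace ℝ (Fin n)) :
    Integrable (fun p => pathDensity n (m + 1) 1 0 p * ∏ k,
      boxTaylor K (fun i => EuclideanSpace.single i (1 : ℝ)) V x (fun i => r * (p k).2 i)) ∧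
    ∫ p, pathDensity n (m + 1) 1 0 p * ∏ k,
      boxTaylor K (fun i => EuclideanSpace.single i (1 : ℝ)) V x (fun i => r * (p k).2 i) =
      ∑ α : Fin (m + 1) → Fin n → Fin K, r ^ (∑ k, ∑ i, (α k i : ℕ)) *
        cCoeff n m (fun k i => α k i) * ∏ k, mderiv (fun i => (α k i : ℕ)) V x := by
  simp_rw [prod_boxTaylor_smul, Finset.mul_sum, mul_left_comm (pathDensity _ _ _ _ _)]
  have h := fun α : Fin (m + 1) → Fin n → Fin K =>
    (integrable_pathDensity_mul_monomial (fun k i => (α k i : ℕ))).const_mul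
    (r ^ (∑ k, ∑ i, (α k i : ℕ)) *
        (∏ k, ∏ i, (Nat.factorial (α k i : ℕ) : ℝ))⁻¹ * ∏ k, mderiv (fun i => (α k i : ℕ)) V x)
  refine ⟨integrable_finsetSum _ fun α _ => h α, ?_⟩
  rw [integral_finsetSum _ fun α _ => h α]
  refine Finset.sum_congr rfl fun α _ => ?_
  rw [integral_const_mul, cCoeff_eq_integral_pathDensity]
  ring

lemma integral_prod_mderiv {Ω : Set (EuclideanSpace ℝ (Fin n))} {S : Set (EuclideanSpace ℝ (Fin n))}
    (hS : IsCompact S) (hSΩ : S ⊆ Ω) (hV : SmoothSupportedIn S V) (m : ℕ)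
    (α : Fin (m + 1) → Fin n → ℕ) :
    Integrable (fun x => ∏ k, mderiv (α k) V x) ∧
    ∫ x, ∏ k, mderiv (α k) V x = Pcoef n m Ω α V := by
  have h0 : ∀ x ∉ S, ∏ k, mderiv (α k) V x = 0 := fun x hx =>
    Finset.prod_eq_zero (Finset.mem_univ 0) ((hV.multiDirDeriv _ _).eq_zero hx)
  constructor
  · refine Continuous.integrable_of_hasCompactSupport
      (continuous_finsetProd _ fun k _ => (hV.multiDirDeriv _ _).1.continuous)
      (HasCompactSupport.intro hS h0)
  · rw [Pcoef, setIntegral_eq_integral_of_forall_compl_eq_zero]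
    exact fun x hx => h0 x fun h => hx (hSΩ h)

end

section

variable {n : ℕ} {V : EuclideanSpace ℝ (Fin n) → ℝ} {S : Set (EuclideanSpace ℝ (Fin n))}

lemma SmoothSupportedIn.exists_boxTaylor_smul_bounds (hS : IsCompact S)
    (hV : SmoothSupportedIn S V) (K : ℕ) :
    ∃ (C : ℝ) (N : ℕ), 1 ≤ C ∧ ∀ x w : EuclideanSpace ℝ (Fin n), ∀ r ∈ Set.Ioc (0 : ℝ) 1,
      |V (x + r • w)| ≤ C * (1 + ‖w‖) ^ N ∧
      |boxTaylor K (fun i => EuclideanSpace.single i (1 : ℝ)) V x (fun i => r * w i)| ≤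
        C * (1 + ‖w‖) ^ N ∧
      |V (x + r • w) -
          boxTaylor K (fun i => EuclideanSpace.single i (1 : ℝ)) V x (fun i => r * w i)| ≤
        C * r ^ K * (1 + ‖w‖) ^ N * (S.indicator 1 x + S.indicator 1 (x + r • w)) := by
  obtain ⟨C₀, hC₀, h₀⟩ := hV.exists_abs_le hS
  obtain ⟨C₁, M, hC₁, h₁⟩ :=
    hV.exists_boxTaylor_bound hS K (fun i : Fin n => EuclideanSpace.single i (1 : ℝ))
  obtain ⟨C₂, hC₂, h₂⟩ :=
    hV.exists_abs_boxTaylor_le hS K (fun i : Fin n => EuclideanSpace.single i (1 : ℝ))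
  refine ⟨1 + C₀ + C₁ + C₂, K + M + K * n, by linarith, fun x w r ⟨hr, hr1⟩ => ?_⟩
  have hw : 0 ≤ ‖w‖ := norm_nonneg w
  have hρ : r * ‖w‖ ≤ ‖w‖ := mul_le_of_le_one_left hw hr1
  have hρ0 : 0 ≤ r * ‖w‖ := by positivity
  have hu : ∀ i, |r * w i| ≤ r * ‖w‖ := fun i => by
    rw [abs_mul, abs_of_pos hr]
    exact mul_le_mul_of_nonneg_left (PiLp.norm_apply_le w i) hr.le
  have hpow : ∀ a, a ≤ K + M + K * n → (1 + ‖w‖) ^ a ≤ (1 + ‖w‖) ^ (K + M + K * n) :=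
    fun a ha => pow_le_pow_right₀ (by linarith) ha
  have hone : 1 ≤ (1 + ‖w‖) ^ (K + M + K * n) := one_le_pow₀ (by linarith)
  refine ⟨?_, ?_, ?_⟩
  · calc _ ≤ C₀ := h₀ _
      _ ≤ C₀ * (1 + ‖w‖) ^ (K + M + K * n) := le_mul_of_one_le_right hC₀ hone
      _ ≤ _ := by gcongr; linarith
  · calc _ ≤ C₂ * (1 + r * ‖w‖) ^ (K * n) := h₂ x _ _ hu hρ0
      _ ≤ C₂ * (1 + ‖w‖) ^ (K * n) := by gcongr
      _ ≤ C₂ * (1 + ‖w‖) ^ (K + M + K * n) := by gcongr ?_ * ?_; exact hpow _ (by omega)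
      _ ≤ _ := by gcongr; linarith
  · by_cases hx : x ∈ S ∨ x + r • w ∈ S
    · have hind : (1 : ℝ) ≤ S.indicator 1 x + S.indicator 1 (x + r • w) := by
        have h0 : ∀ y, (0 : ℝ) ≤ S.indicator 1 y :=
          fun y => Set.indicator_nonneg (fun _ _ => zero_le_one) y
        rcases hx with h | h
        · have := h0 (x + r • w)
          rw [Set.indicator_of_mem h, Pi.one_apply]
          linarith
        · have := h0 x
          rw [Set.indicator_of_mem h, Pi.one_apply]
          linarith
      have hsum : x + ∑ i, (r * w i) • EuclideanSpace.single i (1 : ℝ) = x + r • w := by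
        conv_rhs => rw [eq_sum_smul_single w, Finset.smul_sum]
        simp_rw [smul_smul]
      have h := h₁ x (fun i => r * w i) _ hu hρ0
      rw [hsum] at h
      refine le_trans ?_ (le_mul_of_one_le_right (by positivity) hind)
      calc _ ≤ C₁ * ((r * ‖w‖) ^ K * (1 + r * ‖w‖) ^ M) := h
        _ ≤ C₁ * ((r * (1 + ‖w‖)) ^ K * (1 + ‖w‖) ^ M) := by gcongr; linarith
        _ = C₁ * r ^ K * (1 + ‖w‖) ^ (K + M) := by rw [mul_pow, pow_add]; ring
        _ ≤ C₁ * r ^ K * (1 + ‖w‖) ^ (K + M + K * n) := by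
            gcongr ?_ * ?_; exact hpow _ (by omega)
        _ ≤ _ := by gcongr; linarith
    · obtain ⟨h1, h2⟩ := not_or.1 hx
      rw [hV.eq_zero h2, hV.boxTaylor_eq_zero K _ h1, Set.indicator_of_notMem h1,
        Set.indicator_of_notMem h2]
      simp

lemma SmoothSupportedIn.exists_abs_prod_sub_prod_boxTaylor_le (hS : IsCompact S)
    (hV : SmoothSupportedIn S V) (m K : ℕ) :
    ∃ (C : ℝ) (N : ℕ), 0 ≤ C ∧ ∀ x (p : Fin m → ℝ × EuclideanSpace ℝ (Fin n)),
      ∀ r ∈ Set.Ioc (0 : ℝ) 1,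
      |∏ k, V (x + r • (p k).2) - ∏ k,
          boxTaylor K (fun i => EuclideanSpace.single i (1 : ℝ)) V x (fun i => r * (p k).2 i)| ≤
        C * r ^ K * (∏ k, (1 + ‖(p k).2‖) ^ N) *
          ∑ k, (S.indicator 1 x + S.indicator 1 (x + r • (p k).2)) := by
  obtain ⟨C, N, hC, h⟩ := hV.exists_boxTaylor_smul_bounds hS K
  refine ⟨C ^ m * C, 2 * N, by positivity, fun x p r hr => ?_⟩
  have hr0 := hr.1
  have hone : ∀ k, 1 ≤ (1 + ‖(p k).2‖) ^ N := fun k =>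
    one_le_pow₀ (by linarith [norm_nonneg (p k).2])
  have hind : ∀ y, (0 : ℝ) ≤ S.indicator 1 y :=
    fun y => Set.indicator_nonneg (fun _ _ => zero_le_one) y
  refine (abs_prod_sub_prod_le _ _ (fun k => C * (1 + ‖(p k).2‖) ^ N)
    (fun k => one_le_mul_of_one_le_of_one_le hC (hone k)) (fun k => (h x (p k).2 r hr).1)
    (fun k => (h x (p k).2 r hr).2.1)).trans ?_
  have hle : ∀ k, (1 + ‖(p k).2‖) ^ N ≤ ∏ k, (1 + ‖(p k).2‖) ^ N := fun k => by
    rw [← Finset.mul_prod_erase _ _ (Finset.mem_univ k)]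
    exact le_mul_of_one_le_right (by positivity) (Finset.one_le_prod fun i _ => hone i)
  have hsum : ∑ k, |V (x + r • (p k).2) -
      boxTaylor K (fun i => EuclideanSpace.single i (1 : ℝ)) V x (fun i => r * (p k).2 i)| ≤
      C * r ^ K * (∏ k, (1 + ‖(p k).2‖) ^ N) *
        ∑ k, (S.indicator 1 x + S.indicator 1 (x + r • (p k).2)) := by
    rw [Finset.mul_sum]
    refine Finset.sum_le_sum fun k _ => ((h x (p k).2 r hr).2.2).trans ?_
    have := hind x
    have := hind (x + r • (p k).2)
    gcongr
    exact hle k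
  calc _ ≤ (∏ k, C * (1 + ‖(p k).2‖) ^ N) * (C * r ^ K * (∏ k, (1 + ‖(p k).2‖) ^ N) *
        ∑ k, (S.indicator 1 x + S.indicator 1 (x + r • (p k).2))) := by gcongr
    _ = _ := by
      simp only [Finset.prod_mul_distrib, Finset.prod_const, Finset.card_univ, Fintype.card_fin,
        mul_comm 2 N, pow_mul, Finset.prod_pow]
      ring

lemma SmoothSupportedIn.exists_integral_remainder_le (hS : IsCompact S)
    (hV : SmoothSupportedIn S V) (m K : ℕ) :
    ∃ C : ℝ, 0 ≤ C ∧ ∀ r ∈ Set.Ioc (0 : ℝ) 1,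
      |∫ x, ∫ p, pathDensity n m 1 0 p * (∏ k, V (x + r • (p k).2) - ∏ k,
        boxTaylor K (fun i => EuclideanSpace.single i (1 : ℝ)) V x (fun i => r * (p k).2 i))| ≤
        C * r ^ K := by
  obtain ⟨C, N, hC, h⟩ := hV.exists_abs_prod_sub_prod_boxTaylor_le hS m K
  set ψ : EuclideanSpace ℝ (Fin n) → ℝ := S.indicator 1 with hψ
  have hψi : Integrable ψ := by
    rw [hψ, integrable_indicator_iff hS.measurableSet]
    exact integrableOn_const hS.measure_lt_top.ne
  have hψm : Measurable ψ := measurable_one.indicator hS.measurableSet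
  have hψ0 : ∀ y, 0 ≤ ψ y := fun y => Set.indicator_nonneg (fun _ _ => zero_le_one) y
  set ω : (Fin m → ℝ × EuclideanSpace ℝ (Fin n)) → ℝ := fun p =>
    pathDensity n m 1 0 p * ∏ k, (1 + ‖(p k).2‖) ^ N with hω
  have hωi : Integrable ω := integrable_pathDensity_mul_moment n m N
  have hωm : Measurable ω := (measurable_pathDensity_right n m 1 0).mul (by fun_prop)
  have h0 := pathDensity_nonneg (n := n) m zero_le_one 0
  have hω0 : 0 ≤ ∫ p, ω p := integral_nonneg fun p => mul_nonneg (h0 p) (by positivity)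
  refine ⟨C * (m * (2 * ((∫ p, ω p) * ∫ x, ψ x))),
    mul_nonneg hC (mul_nonneg (by positivity) (mul_nonneg (by positivity)
      (mul_nonneg hω0 (integral_nonneg hψ0)))), fun r hr => ?_⟩
  have hr0 := hr.1
  have hI₀ := integrable_mul_comp_add hωi hωm hψi hψm (a := fun _ => 0) measurable_const
  have hI := fun k => integrable_mul_comp_add hωi hωm hψi hψm (a := fun p => r • (p k).2)
    (by fun_prop)
  have hg : Integrable (fun q : EuclideanSpace ℝ (Fin n) ×
      (Fin m → ℝ × EuclideanSpace ℝ (Fin n)) => C * r ^ K *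
        ∑ k, (ω q.2 * ψ (q.1 + 0) + ω q.2 * ψ (q.1 + r • (q.2 k).2))) (volume.prod volume) :=
    (integrable_finsetSum _ fun k _ => hI₀.1.add (hI k).1).const_mul _
  have hmeas : Measurable fun q : EuclideanSpace ℝ (Fin n) ×
      (Fin m → ℝ × EuclideanSpace ℝ (Fin n)) => pathDensity n m 1 0 q.2 *
      (∏ k, V (q.1 + r • (q.2 k).2) - ∏ k, boxTaylor K
        (fun i => EuclideanSpace.single i (1 : ℝ)) V q.1 (fun i => r * (q.2 k).2 i)) := by
    have hVc := hV.1.continuous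
    have hT := hV.continuous_boxTaylor K (fun i : Fin n => EuclideanSpace.single i (1 : ℝ))
    refine ((measurable_pathDensity_right n m 1 0).comp measurable_snd).mul
      (Continuous.measurable (Continuous.sub (by fun_prop) ?_))
    exact continuous_finsetProd _ fun k _ => hT.comp (f := fun q : EuclideanSpace ℝ (Fin n) ×
      (Fin m → ℝ × EuclideanSpace ℝ (Fin n)) => (q.1, fun i => r * (q.2 k).2 i)) (by fun_prop)
  obtain ⟨-, h2⟩ := abs_integral_integral_le hmeas hg (fun q => by
    rw [abs_mul, abs_of_nonneg (h0 q.2)]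
    refine (mul_le_mul_of_nonneg_left (h q.1 q.2 r hr) (h0 q.2)).trans_eq ?_
    simp only [← mul_add, ← Finset.mul_sum, hω, add_zero]
    ring)
  refine h2.trans_eq ?_
  rw [integral_const_mul, integral_finsetSum _ fun k _ => by exact hI₀.1.add (hI k).1]
  simp_rw [fun k => integral_add hI₀.1 (hI k).1, hI₀.2, fun k => (hI k).2]
  simp
  ring

/-- Small-scale expansion of the integrated rescaled trace density. -/
lemma SmoothSupportedIn.exists_integral_traceDensity_expansion
    {Ω : Set (EuclideanSpace ℝ (Fin n))} (hS : IsCompact S) (hSΩ : S ⊆ Ω)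
    (hV : SmoothSupportedIn S V) (m K : ℕ) :
    ∃ C : ℝ, 0 ≤ C ∧ ∀ r ∈ Set.Ioc (0 : ℝ) 1,
      |(∫ x, traceDensity V (m + 1) r x) - ∑ α : Fin (m + 1) → Fin n → Fin K,
        r ^ (∑ k, ∑ i, (α k i : ℕ)) *
          (cCoeff n m (fun k i => α k i) * Pcoef n m Ω (fun k i => α k i) V)| ≤ C * r ^ K := by
  obtain ⟨C, hC, h⟩ := hV.exists_integral_remainder_le hS (m + 1) K
  obtain ⟨B, hB0, hB⟩ := hV.exists_abs_le hS
  have hVc := hV.1.continuous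
  have hVi : Integrable V := hVc.integrable_of_hasCompactSupport
    (hS.of_isClosed_subset (isClosed_tsupport V) hV.2)
  refine ⟨C, hC, fun r hr => (le_of_eq ?_).trans (h r hr)⟩
  have hin : ∀ x, ∫ p, pathDensity n (m + 1) 1 0 p * (∏ k, V (x + r • (p k).2) - ∏ k,
        boxTaylor K (fun i => EuclideanSpace.single i (1 : ℝ)) V x (fun i => r * (p k).2 i)) =
      traceDensity V (m + 1) r x - ∑ α : Fin (m + 1) → Fin n → Fin K,
        r ^ (∑ k, ∑ i, (α k i : ℕ)) * cCoeff n m (fun k i => α k i) *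
          ∏ k, mderiv (fun i => (α k i : ℕ)) V x := by
    intro x
    obtain ⟨h1, h2⟩ := integral_pathDensity_mul_prod_boxTaylor (V := V) m K r x
    have h3 : Integrable fun p => pathDensity n (m + 1) 1 0 p * ∏ k, V (x + r • (p k).2) := by
      refine integrable_pathDensity_mul 0 (B := B ^ (m + 1)) (by fun_prop) fun p => ?_
      rw [Finset.abs_prod]
      calc _ ≤ ∏ _k : Fin (m + 1), B :=
            Finset.prod_le_prod (fun _ _ => abs_nonneg _) fun k _ => hB _
        _ = _ := by simp
    simp_rw [mul_sub]
    rw [integral_sub h3 h1, h2, traceDensity]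
  have hα := fun α : Fin (m + 1) → Fin n → Fin K =>
    integral_prod_mderiv hS hSΩ hV m (fun k i => (α k i : ℕ))
  simp_rw [hin]
  rw [integral_sub (traceDensity_bound hVc hVi hB m r).1
    (integrable_finsetSum _ fun α _ => (hα α).1.const_mul _),
    integral_finsetSum _ fun α _ => (hα α).1.const_mul _]
  simp_rw [integral_const_mul, fun α => (hα α).2, mul_assoc]

end

lemma tsum_multiindex_eq_sum_box {n m K d : ℕ} (hd : d < K) (F : (Fin m → Fin n → ℕ) → ℝ) :
    (∑' α : Fin m → Fin n → ℕ, if ∑ k, ∑ i, α k i = d then F α else 0) =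
      ∑ β : Fin m → Fin n → Fin K,
        if ∑ k, ∑ i, (β k i : ℕ) = d then F (fun k i => β k i) else 0 := by
  have hinj : Function.Injective
      fun (β : Fin m → Fin n → Fin K) (k : Fin m) (i : Fin n) => (β k i : ℕ) :=
    fun β γ h => funext fun k => funext fun i => Fin.ext (congrFun (congrFun h k) i)
  rw [← hinj.tsum_eq, tsum_fintype]
  intro α hα
  have hαd : ∑ k, ∑ i, α k i = d := by
    by_contra h
    exact hα (if_neg h)
  refine ⟨fun k i => ⟨α k i, lt_of_le_of_lt ?_ hd⟩, rfl⟩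
  calc α k i ≤ ∑ i, α k i := Finset.single_le_sum (fun _ _ => Nat.zero_le _) (Finset.mem_univ i)
    _ ≤ ∑ k, ∑ i, α k i := Finset.single_le_sum (f := fun k => ∑ i, α k i)
        (fun _ _ => Nat.zero_le _) (Finset.mem_univ k)
    _ = d := hαd

lemma abs_pow_mul_sub_sum_even_le {r a : ℝ} (hr : r ∈ Set.Ioc (0 : ℝ) 1) {p d : ℕ} (hd : 0 < d)
    (ha : Odd d → a = 0) :
    |r ^ d * a - ∑ ℓ ∈ Finset.Icc 1 p, if d = 2 * ℓ then r ^ (2 * ℓ) * a else 0| ≤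
      |a| * r ^ (2 * (p + 1)) := by
  have hr0 := hr.1
  rcases Nat.even_or_odd' d with ⟨q, rfl | rfl⟩
  · have e : ∀ ℓ, (2 * q = 2 * ℓ) ↔ q = ℓ := fun ℓ => by omega
    simp_rw [e]
    rw [Finset.sum_ite_eq]
    split_ifs with h
    · rw [sub_self, abs_zero]
      positivity
    · rw [sub_zero, abs_mul, abs_of_nonneg (by positivity), mul_comm]
      rw [Finset.mem_Icc] at h
      exact mul_le_mul_of_nonneg_left (pow_le_pow_of_le_one hr0.le hr.2 (by omega)) (abs_nonneg _)
  · simp [ha ⟨q, rfl⟩]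

section

variable {n : ℕ} {V : EuclideanSpace ℝ (Fin n) → ℝ}

lemma sum_pow_mul_Pscr (Ω : Set (EuclideanSpace ℝ (Fin n))) (p : ℕ) (r : ℝ) :
    ∑ ℓ ∈ Finset.Icc 1 p, (r ^ 2) ^ ℓ * Pscr n Ω ℓ V =
      ∑ m ∈ Finset.range p, (-1 : ℝ) ^ (m + 1) * ∑ β : Fin (m + 1) → Fin n → Fin (2 * p),
        ∑ ℓ ∈ Finset.Icc 1 p, if ∑ k, ∑ i, (β k i : ℕ) + 2 * (m + 1) = 2 * ℓ then
          r ^ (2 * ℓ) * (cCoeff n m (fun k i => β k i) * Pcoef n m Ω (fun k i => β k i) V)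
          else 0 := by
  have h : ∀ ℓ ∈ Finset.Icc 1 p, (r ^ 2) ^ ℓ * Pscr n Ω ℓ V =
      ∑ m ∈ Finset.range p, (-1 : ℝ) ^ (m + 1) * ∑ β : Fin (m + 1) → Fin n → Fin (2 * p),
        if ∑ k, ∑ i, (β k i : ℕ) + 2 * (m + 1) = 2 * ℓ then
          r ^ (2 * ℓ) * (cCoeff n m (fun k i => β k i) * Pcoef n m Ω (fun k i => β k i) V)
          else 0 := by
    intro ℓ hℓ
    rw [Finset.mem_Icc] at hℓ
    rw [Pscr, Finset.mul_sum]
    refine Eq.trans (Finset.sum_congr rfl fun m hm => ?_)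
      (Finset.sum_subset (Finset.range_mono hℓ.2) fun m _ hm => ?_)
    · rw [Finset.mem_range] at hm
      rw [tsum_multiindex_eq_sum_box (K := 2 * p) (by omega), mul_left_comm, Finset.mul_sum]
      congr 1
      refine Finset.sum_congr rfl fun β _ => ?_
      have e : (∑ k, ∑ i, (β k i : ℕ) = 2 * ℓ - 2 * (m + 1)) ↔
          (∑ k, ∑ i, (β k i : ℕ) + 2 * (m + 1) = 2 * ℓ) := by omega
      simp only [e, mul_ite, mul_zero, pow_mul]
    · rw [Finset.mem_range] at hm
      rw [Finset.sum_eq_zero, mul_zero]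
      exact fun β _ => if_neg (by omega)
  rw [Finset.sum_congr rfl h, Finset.sum_comm]
  refine Finset.sum_congr rfl fun m _ => ?_
  rw [← Finset.mul_sum, Finset.sum_comm]

lemma SmoothSupportedIn.exists_sum_traceDensity_expansion
    {S Ω : Set (EuclideanSpace ℝ (Fin n))} (hS : IsCompact S) (hSΩ : S ⊆ Ω)
    (hV : SmoothSupportedIn S V) (p : ℕ) :
    ∃ C : ℝ, 0 ≤ C ∧ ∀ r ∈ Set.Ioc (0 : ℝ) 1,
      |∑ m ∈ Finset.range p, (-1) ^ (m + 1) * (r ^ (2 * (m + 1)) *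
          ∫ x, traceDensity V (m + 1) r x) -
        ∑ ℓ ∈ Finset.Icc 1 p, (r ^ 2) ^ ℓ * Pscr n Ω ℓ V| ≤ C * r ^ (2 * (p + 1)) := by
  choose C hC h using fun m => hV.exists_integral_traceDensity_expansion hS hSΩ m (2 * p)
  refine ⟨∑ m ∈ Finset.range p, (C m + ∑ β : Fin (m + 1) → Fin n → Fin (2 * p),
    |cCoeff n m (fun k i => β k i) * Pcoef n m Ω (fun k i => β k i) V|),
    Finset.sum_nonneg fun m _ => add_nonneg (hC m) (Finset.sum_nonneg fun _ _ => abs_nonneg _),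
    fun r hr => ?_⟩
  have hr0 := hr.1
  rw [sum_pow_mul_Pscr, ← Finset.sum_sub_distrib, Finset.sum_mul]
  refine (Finset.abs_sum_le_sum_abs _ _).trans (Finset.sum_le_sum fun m _ => ?_)
  rw [← mul_sub, abs_mul, abs_pow, abs_neg, abs_one, one_pow, one_mul, add_mul]
  refine (abs_sub_le _ (r ^ (2 * (m + 1)) * ∑ β : Fin (m + 1) → Fin n → Fin (2 * p),
    r ^ (∑ k, ∑ i, (β k i : ℕ)) *
      (cCoeff n m (fun k i => β k i) * Pcoef n m Ω (fun k i => β k i) V)) _).trans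
    (add_le_add ?_ ?_)
  · rw [← mul_sub, abs_mul, abs_of_nonneg (by positivity)]
    calc _ ≤ r ^ (2 * (m + 1)) * (C m * r ^ (2 * p)) := by gcongr; exact h m r hr
      _ = C m * r ^ (2 * (m + 1) + 2 * p) := by ring
      _ ≤ _ := mul_le_mul_of_nonneg_left (pow_le_pow_of_le_one hr0.le hr.2 (by omega)) (hC m)
  · rw [Finset.mul_sum, ← Finset.sum_sub_distrib, Finset.sum_mul]
    refine (Finset.abs_sum_le_sum_abs _ _).trans (Finset.sum_le_sum fun β _ => ?_)
    rw [← mul_assoc, ← pow_add, add_comm (2 * (m + 1))]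
    refine abs_pow_mul_sub_sum_even_le hr (by omega) fun hodd => ?_
    rw [cCoeff_eq_zero_of_odd, zero_mul]
    rw [Nat.odd_iff] at hodd ⊢
    omega

end

theorem heat_trace_asymptotics (n : ℕ) (Ω : Set (EuclideanSpace ℝ (Fin n)))
    (hΩ : IsOpen Ω) (hbdd : Bornology.IsBounded Ω)
    (V : EuclideanSpace ℝ (Fin n) → ℝ) (hV : ContDiff ℝ (⊤ : ℕ∞) V)
    (hcpt : HasCompactSupport V) (hsupp : tsupport V ⊆ Ω)
    (p : ℕ) (hp : 1 ≤ p) :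
    ∃ C > (0 : ℝ), ∃ t₀ > (0 : ℝ), ∀ t ∈ Set.Ioo (0 : ℝ) t₀,
      Summable (fun j : ℕ => |∫ x : EuclideanSpace ℝ (Fin n), Gam n V (j + 1) t x x|) ∧
      |(∑' j : ℕ, ∫ x : EuclideanSpace ℝ (Fin n), Gam n V (j + 1) t x x) -
          t ^ (-(n : ℝ) / 2) * ∑ ℓ ∈ Finset.Icc 1 p, t ^ ℓ * Pscr n Ω ℓ V| ≤
        C * t ^ ((p : ℝ) + 1 - (n : ℝ) / 2) := by
  have hS : IsCompact (tsupport V) := hcpt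
  have hVs : SmoothSupportedIn (tsupport V) V := ⟨hV, subset_rfl⟩
  have hVc := hV.continuous
  have hVi : Integrable V := hVc.integrable_of_hasCompactSupport hcpt
  obtain ⟨B, -, hB⟩ := hVs.exists_abs_le hS
  obtain ⟨C, hC, hhead⟩ := hVs.exists_sum_traceDensity_expansion hS hsupp p
  have hG : 0 ≤ heatG n 1 0 := heatG_nonneg zero_le_one 0
  set D : ℕ → ℝ := fun j => heatG n 1 0 * (∫ x, |V x|) * (|B| ^ j / j.factorial) with hD
  have hD0 : ∀ j, 0 ≤ D j := fun j =>
    mul_nonneg (mul_nonneg hG (integral_nonneg fun _ => abs_nonneg _)) (by positivity)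
  have hDs : Summable D := (Real.summable_pow_div_factorial |B|).mul_left _
  have hDt : 0 ≤ ∑' j, D (j + p) := tsum_nonneg fun j => hD0 (j + p)
  refine ⟨C + ∑' j, D (j + p) + 1, by linarith, 1, one_pos,
    fun t ⟨ht0, ht1⟩ => ?_⟩
  obtain ⟨r, hr0, rfl⟩ : ∃ r : ℝ, 0 < r ∧ t = r ^ 2 :=
    ⟨√t, Real.sqrt_pos.2 ht0, (Real.sq_sqrt ht0.le).symm⟩
  have hr1 : r ≤ 1 := by nlinarith
  have hrn : 0 < (r ^ n)⁻¹ := by positivity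
  have hpow : ∀ y : ℝ, (r ^ 2) ^ y = r ^ (2 * y) := fun y => by
    rw [← Real.rpow_natCast, ← Real.rpow_mul hr0.le, Nat.cast_ofNat]
  have e1 : (r ^ 2) ^ (-(n : ℝ) / 2) = (r ^ n)⁻¹ := by
    rw [hpow, ← Real.rpow_natCast, ← Real.rpow_neg hr0.le]
    congr 1
    ring
  have e2 : (r ^ 2) ^ ((p : ℝ) + 1 - (n : ℝ) / 2) = r ^ (2 * (p + 1)) * (r ^ n)⁻¹ := by
    rw [hpow, ← Real.rpow_natCast, ← Real.rpow_natCast, ← Real.rpow_neg hr0.le,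
      ← Real.rpow_add hr0]
    congr 1
    push_cast
    ring
  have hΦ : ∀ j, ∫ x, Gam n V (j + 1) (r ^ 2) x x =
      (r ^ n)⁻¹ * ((-1) ^ (j + 1) * (r ^ (2 * (j + 1)) * ∫ x, traceDensity V (j + 1) r x)) := by
    intro j
    simp_rw [Gam_diag_eq_traceDensity hVc.measurable hB (j + 1) hr0]
    rw [integral_const_mul]
    ring
  have hbound : ∀ j, |∫ x, Gam n V (j + 1) (r ^ 2) x x| ≤
      (r ^ n)⁻¹ * (r ^ (2 * (j + 1)) * D j) := by
    intro j
    rw [hΦ, abs_mul, abs_of_pos hrn, abs_mul, abs_pow, abs_neg, abs_one, one_pow, one_mul, abs_mul,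
      abs_of_pos (by positivity : 0 < r ^ (2 * (j + 1)))]
    have h := (traceDensity_bound hVc hVi (fun z => (hB z).trans (le_abs_self B)) j r).2
    have h1 : |B| ^ j / ((j + 1).factorial : ℝ) ≤ |B| ^ j / j.factorial := by
      gcongr
      exact Nat.le_succ j
    gcongr
    exact h.trans (mul_le_mul_of_nonneg_left h1
      (mul_nonneg hG (integral_nonneg fun _ => abs_nonneg _)))
  have hsum : Summable fun j => |∫ x, Gam n V (j + 1) (r ^ 2) x x| := by
    refine Summable.of_nonneg_of_le (fun _ => abs_nonneg _) (fun j => (hbound j).trans ?_)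
      (hDs.mul_left (r ^ n)⁻¹)
    gcongr
    exact mul_le_of_le_one_left (hD0 j) (pow_le_one₀ hr0.le hr1)
  refine ⟨hsum, ?_⟩
  have htail : |∑' j, ∫ x, Gam n V (j + p + 1) (r ^ 2) x x| ≤
      (r ^ n)⁻¹ * (r ^ (2 * (p + 1)) * ∑' j, D (j + p)) := by
    rw [← tsum_mul_left, ← tsum_mul_left]
    refine tsum_of_norm_bounded
      (f := fun j => ∫ x, Gam n V (j + p + 1) (r ^ 2) x x) ((((summable_nat_add_iff p).2 hDs).mul_left _).mul_left _).hasSum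
      fun j => (hbound (j + p)).trans ?_
    have := hD0 (j + p)
    gcongr ?_ * (?_ * ?_)
    exact pow_le_pow_of_le_one hr0.le hr1 (by omega)
  rw [← hsum.of_abs.sum_add_tsum_nat_add p, e1, e2, add_sub_right_comm]
  have hhead' : |(∑ j ∈ Finset.range p, ∫ x, Gam n V (j + 1) (r ^ 2) x x) -
      (r ^ n)⁻¹ * ∑ ℓ ∈ Finset.Icc 1 p, (r ^ 2) ^ ℓ * Pscr n Ω ℓ V| ≤
      (r ^ n)⁻¹ * (C * r ^ (2 * (p + 1))) := by
    simp_rw [hΦ]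
    rw [← Finset.mul_sum, ← mul_sub, abs_mul, abs_of_pos hrn]
    gcongr
    exact hhead r ⟨hr0, hr1⟩
  have hpos : 0 ≤ (r ^ n)⁻¹ * r ^ (2 * (p + 1)) := by positivity
  refine (abs_add_le _ _).trans ?_
  linear_combination hhead' + htail + hpos
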